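/- For every integer j ≥ 3 and every integer d ≥ 2, there exist number fields K and K' with [K:ℚ] = [K':ℚ] = 2^j that are not isomorphic as fields, a central division algebra A of degree d over K and a central division algebra A' of degree d over K', such that for every finite-dimensional central simple ℚ-algebra B, B lies in the fiber (Res_{K/ℚ})⁻¹(A) if and only if B lies in the fiber (Res_{K'/ℚ})⁻¹(A'), and there exists at least one finite-dimensional central simple ℚ-algebra B₀ lying in both fibers. -/

import Mathlib

open TensorProduct

/-- A bundled finite-dimensional central simple algebra over the field `k`. -/
structure CSAlg (k : Type) [Field k] : Type 1 where
  carrier : Type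
  [ring : Ring carrier]
  [alg : Algebra k carrier]
  finiteDimensional : FiniteDimensional k carrier
  isSimpleRing : IsSimpleRing carrier
  center_le_bot : Subalgebra.center k carrier ≤ ⊥

attribute [instance] CSAlg.ring CSAlg.alg

/-- `A` is a division algebra. -/
def CSAlg.IsDivision {k : Type} [Field k] (A : CSAlg k) : Prop :=
  ∀ x : A.carrier, x ≠ 0 → IsUnit x

/-- `A` has degree `d`, i.e. dimension `d ^ 2` over the base field. -/
def CSAlg.DegreeEq {k : Type} [Field k] (A : CSAlg k) (d : ℕ) : Prop :=
  Module.finrank k A.carrier = d ^ 2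

/-- Brauer equivalence of two `k`-algebras: some matrix algebras over them are
isomorphic as `k`-algebras. -/
def IsBrauerEquiv (k : Type) [Field k] (A : Type) [Ring A] [Algebra k A]
    (B : Type) [Ring B] [Algebra k B] : Prop :=
  ∃ n m : ℕ, 0 < n ∧ 0 < m ∧
    Nonempty (Matrix (Fin n) (Fin n) A ≃ₐ[k] Matrix (Fin m) (Fin m) B)

/-- A central simple `F`-algebra `B` lies in the fiber `(Res_{K/F})⁻¹(A)` if
`B ⊗[F] K` is Brauer-equivalent to `A` over `K`. -/
def InFiber (F : Type) [Field F] (K : Type) [Field K] [Algebra F K]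
    (A : CSAlg K) (B : CSAlg F) : Prop :=
  IsBrauerEquiv K (K ⊗[F] B.carrier) A.carrier

/-- A bundled number field. -/
structure NumField : Type 1 where
  carrier : Type
  [field : Field carrier]
  [numberField : NumberField carrier]

attribute [instance] NumField.field NumField.numberField

theorem isSimpleRing_tensorProduct (F A C : Type*) [Field F] [Ring A] [Algebra F A]
    [IsSimpleRing A] [Ring C] [Algebra F C] [IsSimpleRing C] [Algebra.IsCentral F C] :
    IsSimpleRing (A ⊗[F] C) := by
  classical
  have : Nontrivial (A ⊗[F] C) := inferInstance
  let b := Module.Free.chooseBasis F A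
  let e := TensorProduct.equivFinsuppOfBasisLeft (R := F) (N := C) b
  have he : ∀ (x : A ⊗[F] C) (c c' : C) i,
      e ((1 ⊗ₜ c) * x * (1 ⊗ₜ c')) i = c * e x i * c' := by
    intro x c c' i
    induction x using TensorProduct.induction_on with
    | zero => simp
    | tmul a d => simp [e]
    | add x y hx hy => simp [mul_add, add_mul, hx, hy]
  refine ⟨⟨fun I ↦ ?_⟩⟩
  by_cases hI : I = ⊥
  · exact Or.inl hI
  right
  obtain ⟨y, hyI, hy0⟩ : ∃ y ∈ I, y ≠ 0 := by
    by_contra! h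
    exact hI (le_bot_iff.1 fun x hx ↦ by simpa using h x hx)
  let P : ℕ → Prop := fun n ↦ ∃ x ∈ I, x ≠ 0 ∧ (e x).support.card = n
  have hP : ∃ n, P n := ⟨_, y, hyI, hy0, rfl⟩
  obtain ⟨x, hxI, hx0, hxn⟩ := Nat.find_spec hP
  have hmin : ∀ z ∈ I, (e z).support.card < (e x).support.card → z = 0 := by
    intro z hz hlt
    by_contra hz0
    exact Nat.find_min hP (hxn ▸ hlt) ⟨z, hz, hz0, rfl⟩
  obtain ⟨i₀, hi₀⟩ : ∃ i, e x i ≠ 0 := by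
    by_contra! h
    exact hx0 (e.injective (by ext i; simp [h]))
  let J : TwoSidedIdeal C := TwoSidedIdeal.mk'
    {c | ∃ z ∈ I, (∀ i, e x i = 0 → e z i = 0) ∧ e z i₀ = c}
    ⟨0, I.zero_mem, by simp, by simp⟩
    (by
      rintro _ _ ⟨z, hz, hs, rfl⟩ ⟨w, hw, ht, rfl⟩
      exact ⟨z + w, I.add_mem hz hw, fun i hi ↦ by simp [hs i hi, ht i hi], by simp⟩)
    (by
      rintro _ ⟨z, hz, hs, rfl⟩
      exact ⟨-z, I.neg_mem hz, fun i hi ↦ by simp [hs i hi], by simp⟩)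
    (by
      rintro c _ ⟨z, hz, hs, rfl⟩
      refine ⟨(1 ⊗ₜ c) * z * (1 ⊗ₜ 1), I.mul_mem_right _ _ (I.mul_mem_left _ _ hz),
        fun i hi ↦ by simp only [he, hs i hi, mul_zero, zero_mul], by simp only [he, mul_one]⟩)
    (by
      rintro _ c ⟨z, hz, hs, rfl⟩
      refine ⟨(1 ⊗ₜ 1) * z * (1 ⊗ₜ c), I.mul_mem_right _ _ (I.mul_mem_left _ _ hz),
        fun i hi ↦ by simp only [he, hs i hi, mul_zero, zero_mul], by simp only [he, one_mul]⟩)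
  have hJ : e x i₀ ∈ J := by
    rw [TwoSidedIdeal.mem_mk']
    exact ⟨x, hxI, fun _ h ↦ h, rfl⟩
  have h1 := IsSimpleRing.one_mem_of_ne_zero_mem J hi₀ hJ
  rw [TwoSidedIdeal.mem_mk'] at h1
  obtain ⟨z, hzI, hzs, hz1⟩ := h1
  have hcomm : ∀ c : C, (1 ⊗ₜ c) * z * (1 ⊗ₜ 1) - (1 ⊗ₜ 1) * z * (1 ⊗ₜ c) = 0 := by
    intro c
    refine hmin _ (I.sub_mem (I.mul_mem_right _ _ (I.mul_mem_left _ _ hzI))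
      (I.mul_mem_right _ _ (I.mul_mem_left _ _ hzI))) (Finset.card_lt_card ?_)
    refine (Finset.ssubset_iff_of_subset fun i hi ↦ ?_).2 ⟨i₀, by simpa using hi₀, ?_⟩
    · rw [Finsupp.mem_support_iff, map_sub, Finsupp.sub_apply, he, he] at hi
      rw [Finsupp.mem_support_iff]
      intro h
      simp [hzs i h] at hi
    · rw [Finsupp.notMem_support_iff, map_sub, Finsupp.sub_apply, he, he, hz1]
      simp
  have hcen : ∀ i, ∃ r : F, e z i = algebraMap F C r := by
    intro i
    refine (Algebra.IsCentral.mem_center_iff F).1 (Subalgebra.mem_center_iff.2 fun c ↦ ?_)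
    have := congrArg (fun t ↦ e t i) (hcomm c)
    simpa only [map_sub, Finsupp.sub_apply, he, mul_one, one_mul, map_zero, Finsupp.zero_apply,
      sub_eq_zero] using this
  choose r hr using hcen
  have hz : z = ((e z).sum fun i _ ↦ r i • b i) ⊗ₜ[F] (1 : C) := by
    conv_lhs => rw [← e.symm_apply_apply z]
    rw [TensorProduct.equivFinsuppOfBasisLeft_symm_apply, Finsupp.sum, Finsupp.sum,
      TensorProduct.sum_tmul]
    refine Finset.sum_congr rfl fun i _ ↦ ?_
    rw [hr, Algebra.algebraMap_eq_smul_one, TensorProduct.smul_tmul]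
  set a := (e z).sum fun i _ ↦ r i • b i
  have ha : a ≠ 0 := by
    intro h
    rw [h, TensorProduct.zero_tmul] at hz
    simp [hz] at hz1
  have h1' := IsSimpleRing.one_mem_of_ne_zero_mem
    (I.comap (Algebra.TensorProduct.includeLeft : A →ₐ[F] A ⊗[F] C)) ha
    (by rw [TwoSidedIdeal.mem_comap]; simpa [← hz] using hzI)
  rw [TwoSidedIdeal.mem_comap, map_one] at h1'
  exact (TwoSidedIdeal.one_mem_iff I).1 h1'

namespace IsBrauerEquiv

section

variable {k : Type} [Field k] {A B C : Type} [Ring A] [Algebra k A] [Ring B] [Algebra k B]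
  [Ring C] [Algebra k C]

theorem of_matrix {ι κ : Type} [Fintype ι] [Fintype κ] [DecidableEq ι] [DecidableEq κ]
    [Nonempty ι] [Nonempty κ] (e : Matrix ι ι A ≃ₐ[k] Matrix κ κ B) : IsBrauerEquiv k A B :=
  ⟨Fintype.card ι, Fintype.card κ, Fintype.card_pos, Fintype.card_pos,
    ⟨(Matrix.reindexAlgEquiv k A (Fintype.equivFin ι)).symm.trans
      (e.trans (Matrix.reindexAlgEquiv k B (Fintype.equivFin κ)))⟩⟩

theorem of_algEquiv_matrix {κ : Type} [Fintype κ] [DecidableEq κ] [Nonempty κ]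
    (e : A ≃ₐ[k] Matrix κ κ B) : IsBrauerEquiv k A B :=
  of_matrix (ι := Unit) ((Matrix.uniqueAlgEquiv (m := Unit)).trans e)

theorem of_algEquiv (e : A ≃ₐ[k] B) : IsBrauerEquiv k A B :=
  of_matrix (e.mapMatrix (m := Unit))

theorem symm (h : IsBrauerEquiv k A B) : IsBrauerEquiv k B A := by
  obtain ⟨n, m, hn, hm, ⟨e⟩⟩ := h
  exact ⟨m, n, hm, hn, ⟨e.symm⟩⟩

theorem trans (hAB : IsBrauerEquiv k A B) (hBC : IsBrauerEquiv k B C) : IsBrauerEquiv k A C := by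
  obtain ⟨n, m, hn, hm, ⟨e⟩⟩ := hAB
  obtain ⟨p, q, hp, hq, ⟨f⟩⟩ := hBC
  have := Fin.pos_iff_nonempty.1 hn
  have := Fin.pos_iff_nonempty.1 hm
  have := Fin.pos_iff_nonempty.1 hp
  have := Fin.pos_iff_nonempty.1 hq
  exact of_matrix <| (Matrix.compAlgEquiv (Fin p) (Fin n) A k).symm.trans <|
    (e.mapMatrix (m := Fin p)).trans <| (Matrix.compAlgEquiv _ _ _ _).trans <|
    (Matrix.reindexAlgEquiv k B (.prodComm (Fin p) (Fin m))).trans <|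
    (Matrix.compAlgEquiv _ _ _ _).symm.trans <| f.mapMatrix.trans <| Matrix.compAlgEquiv _ _ _ _

end

theorem tensor_right {F k : Type} [Field F] [Field k] [Algebra F k] {A B : Type} [Ring A]
    [Algebra k A] [Algebra F A] [IsScalarTower F k A] [Ring B] [Algebra k B] [Algebra F B]
    [IsScalarTower F k B] (h : IsBrauerEquiv k A B) (C : Type) [Ring C] [Algebra F C] :
    IsBrauerEquiv k (A ⊗[F] C) (B ⊗[F] C) := by
  obtain ⟨n, m, hn, hm, ⟨e⟩⟩ := h
  have := Fin.pos_iff_nonempty.1 hn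
  have := Fin.pos_iff_nonempty.1 hm
  exact of_matrix <| (Matrix.kroneckerTMulAlgEquiv (Fin n) Unit F k A C).symm.trans <|
    (Algebra.TensorProduct.congr e AlgEquiv.refl).trans <|
      Matrix.kroneckerTMulAlgEquiv (Fin m) Unit F k B C

theorem baseChange {F : Type} [Field F] {A B : Type} [Ring A] [Algebra F A] [Ring B]
    [Algebra F B] (h : IsBrauerEquiv F A B) (k : Type) [Field k] [Algebra F k] :
    IsBrauerEquiv k (k ⊗[F] A) (k ⊗[F] B) := by
  obtain ⟨n, m, hn, hm, ⟨e⟩⟩ := h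
  have := Fin.pos_iff_nonempty.1 hn
  have := Fin.pos_iff_nonempty.1 hm
  exact of_matrix <| (Matrix.kroneckerTMulAlgEquiv Unit (Fin n) F k k A).symm.trans <|
    (Algebra.TensorProduct.congr AlgEquiv.refl e).trans <|
      Matrix.kroneckerTMulAlgEquiv Unit (Fin m) F k k B

theorem tensor_split {F k : Type} [Field F] [Field k] [Algebra F k] (A : Type) [Ring A]
    [Algebra k A] [Algebra F A] [IsScalarTower F k A] {C : Type} [Ring C] [Algebra F C]
    {ι : Type} [Fintype ι] [DecidableEq ι] [Nonempty ι] (e : C ≃ₐ[F] Matrix ι ι F) :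
    IsBrauerEquiv k (A ⊗[F] C) A := by
  refine of_matrix (ι := Unit) (κ := Unit × ι) ?_
  exact (Matrix.uniqueAlgEquiv (m := Unit)).trans <| 
    (Algebra.TensorProduct.congr (Matrix.uniqueAlgEquiv (m := Unit)).symm e).trans <|
    (Matrix.kroneckerTMulAlgEquiv Unit ι F k A F).trans
      (Algebra.TensorProduct.rid F k A).mapMatrix

end IsBrauerEquiv

theorem nonempty_tensor_op_algEquiv_matrix (F B : Type) [Field F] [Ring B] [Algebra F B]
    [IsSimpleRing B] [Algebra.IsCentral F B] [FiniteDimensional F B] :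
    Nonempty (B ⊗[F] Bᵐᵒᵖ ≃ₐ[F]
      Matrix (Fin (Module.finrank F B)) (Fin (Module.finrank F B)) F) := by
  have := isSimpleRing_tensorProduct F B Bᵐᵒᵖ
  have hinj : Function.Injective (AlgHom.mulLeftRight F B) :=
    (AlgHom.mulLeftRight F B).toRingHom.injective
  have hdim : Module.finrank F (B ⊗[F] Bᵐᵒᵖ) = Module.finrank F (Module.End F B) := by
    rw [Module.finrank_tensorProduct, Module.finrank_linearMap,
      (MulOpposite.opLinearEquiv F : B ≃ₗ[F] Bᵐᵒᵖ).finrank_eq]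
  have hbij : Function.Bijective (AlgHom.mulLeftRight F B) :=
    ⟨hinj, (LinearMap.injective_iff_surjective_of_finrank_eq_finrank
      (f := (AlgHom.mulLeftRight F B).toLinearMap) hdim).1 hinj⟩
  exact ⟨(AlgEquiv.ofBijective _ hbij).trans (algEquivMatrix (Module.finBasis F B))⟩

/-- Left multiplication by the matrix unit at `(i, j)` moves the `j`-th corner to the `i`-th one,
so a module over `Matrix (Fin n) (Fin n) D` is `n` copies of a `D`-vector space. -/
theorem mul_finrank_dvd_finrank_of_matrix_algHom {F D V : Type} [Field F] [DivisionRing D]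
    [Algebra F D] [FiniteDimensional F D] [AddCommGroup V] [Module F V] [FiniteDimensional F V]
    {n : ℕ} (hn : 0 < n) (f : Matrix (Fin n) (Fin n) D →ₐ[F] Module.End F V) :
    n * Module.finrank F D ∣ Module.finrank F V := by
  let i₀ : Fin n := ⟨0, hn⟩
  have hE : ∀ (a b : Fin n) (x y : D) (v : V), f (.single a i₀ x) (f (.single i₀ b y) v) =
      f (.single a b (x * y)) v := by
    intro a b x y v
    rw [← Module.End.mul_apply, ← map_mul, Matrix.single_mul_single_same]
  let g : D →ₐ[F] Module.End F V := f.comp (Matrix.scalarAlgHom (Fin n) F)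
  let e : Module.End F V := f (.single i₀ i₀ 1)
  have hee : ∀ v, e (e v) = e v := fun v ↦ by simp [e, hE]
  have hge : ∀ c v, g c (e v) = e (g c v) := by
    intro c v
    simp only [g, e, AlgHom.comp_apply, Matrix.scalarAlgHom_apply, ← Module.End.mul_apply,
      ← map_mul]
    congr 2
    ext a b
    simp [Matrix.single_apply]
  let W : Submodule F V := LinearMap.range e
  let : Module D W :=
    { smul := fun c w ↦ ⟨g c w, by
        obtain ⟨v, hv⟩ := w.2
        exact ⟨g c v, by rw [← hge, hv]⟩⟩
      one_smul := fun w ↦ Subtype.ext (by change g 1 w = w; simp)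
      mul_smul := fun a b w ↦ Subtype.ext (by change g (a * b) w = g a (g b w); simp)
      smul_zero := fun a ↦ Subtype.ext (by change g a (0 : W) = 0; simp)
      smul_add := fun a v w ↦ Subtype.ext (by change g a (v + w : W) = g a v + g a w; simp)
      add_smul := fun a b w ↦ Subtype.ext (by change g (a + b) w = g a w + g b w; simp)
      zero_smul := fun w ↦ Subtype.ext (by change g 0 w = 0; simp) }
  have : IsScalarTower F D W := ⟨fun a c w ↦ Subtype.ext (by
    change g (a • c) w = a • g c w
    simp)⟩
  let φ : V ≃ₗ[F] (Fin n → W) :=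
    { toFun := fun v i ↦ ⟨f (.single i₀ i 1) v, f (.single i₀ i 1) v, by simp [e, hE]⟩
      map_add' := fun v w ↦ by ext; simp
      map_smul' := fun a v ↦ by ext; simp
      invFun := fun w ↦ ∑ i, f (.single i i₀ 1) (w i)
      left_inv := fun v ↦ by
        simp only [hE, mul_one]
        rw [← LinearMap.sum_apply, ← map_sum, Matrix.sum_single_one, map_one,
          Module.End.one_apply]
      right_inv := fun w ↦ by
        ext i
        have key : ∀ j, f (.single i₀ i 1) (f (.single j i₀ 1) (w j)) =
            if i = j then (w j : V) else 0 := by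
          intro j
          obtain ⟨v, hv⟩ := (w j).2
          rw [← Module.End.mul_apply, ← map_mul]
          split_ifs with h
          · subst h
            rw [Matrix.single_mul_single_same, ← hv, mul_one]
            exact hee v
          · rw [Matrix.single_mul_single_of_ne _ _ _ _ h, map_zero, LinearMap.zero_apply]
        simp [key] }
  have := Module.Finite.of_restrictScalars_finite F D W
  rw [φ.finrank_eq, Module.finrank_pi_fintype]
  simp only [Finset.sum_const, Finset.card_univ, Fintype.card_fin, smul_eq_mul]
  exact Nat.mul_dvd_mul_left _ ⟨_, (Module.finrank_mul_finrank F D W).symm⟩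

/-- The degree of a division algebra divides the degree of any splitting field. -/
theorem exists_sq_eq_finrank_of_isBrauerEquiv {F K D : Type} [Field F] [Field K] [Algebra F K]
    [FiniteDimensional F K] [DivisionRing D] [Algebra F D] [FiniteDimensional F D]
    (h : IsBrauerEquiv K (K ⊗[F] D) K) :
    ∃ δ, Module.finrank F D = δ ^ 2 ∧ δ ∣ Module.finrank F K := by
  obtain ⟨n, m, hn, hm, ⟨e⟩⟩ := h
  have hdim := e.toLinearEquiv.finrank_eq
  rw [Module.finrank_matrix, Module.finrank_matrix, Module.finrank_baseChange,
    Module.finrank_self] at hdim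
  simp only [Fintype.card_fin, mul_one] at hdim
  let ρ : Module.End K (Fin m → K) →ₐ[F] Module.End F (Fin m → K) :=
    { toFun := fun f ↦ f.restrictScalars F
      map_one' := rfl
      map_mul' := fun _ _ ↦ rfl
      map_zero' := rfl
      map_add' := fun _ _ ↦ rfl
      commutes' := fun a ↦ by ext; simp }
  have hdvd := mul_finrank_dvd_finrank_of_matrix_algHom hn <| ρ.comp <|
    ((Matrix.toLinAlgEquiv' (R := K) (n := Fin m)).toAlgHom.restrictScalars F).comp <|
    (e.toAlgHom.restrictScalars F).comp
      (Algebra.TensorProduct.includeRight : D →ₐ[F] K ⊗[F] D).mapMatrix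
  rw [Module.finrank_pi_fintype] at hdvd
  simp only [Finset.sum_const, Finset.card_univ, Fintype.card_fin, smul_eq_mul] at hdvd
  have hnm : n ∣ m := by
    rw [← Nat.pow_dvd_pow_iff two_ne_zero]
    exact ⟨Module.finrank F D, by rw [pow_two, pow_two, ← hdim]⟩
  obtain ⟨δ, rfl⟩ := hnm
  have hδ : Module.finrank F D = δ ^ 2 := by
    have : 0 < n * n := by positivity
    apply Nat.eq_of_mul_eq_mul_left this
    rw [hdim]
    ring
  refine ⟨δ, hδ, ?_⟩
  rw [hδ, mul_assoc] at hdvd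
  have := Nat.dvd_of_mul_dvd_mul_left hn hdvd
  rw [pow_two] at this
  exact Nat.dvd_of_mul_dvd_mul_left (Nat.pos_of_mul_pos_left hm) this

theorem exists_eq_tmul_one_of_forall_commute {F A C : Type*} [Field F] [Ring A] [Algebra F A]
    [Ring C] [Algebra F C] [Algebra.IsCentral F C] {z : A ⊗[F] C}
    (hz : ∀ c : C, (1 ⊗ₜ c) * z = z * (1 ⊗ₜ c)) : ∃ a : A, z = a ⊗ₜ 1 := by
  have hmem : z ∈ Subalgebra.centralizer F
      ((Algebra.TensorProduct.includeRight : C →ₐ[F] A ⊗[F] C).range : Set (A ⊗[F] C)) := by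
    rw [Subalgebra.mem_centralizer_iff]
    rintro _ ⟨c, rfl⟩
    exact hz c
  rw [Subalgebra.centralizer_range_includeRight_eq_center_tensorProduct] at hmem
  obtain ⟨t, rfl⟩ := hmem
  clear hz
  induction t using TensorProduct.induction_on with
  | zero => exact ⟨0, by simp⟩
  | tmul a c =>
    obtain ⟨r, hr⟩ := (Algebra.IsCentral.mem_center_iff F).1 c.2
    refine ⟨r • a, ?_⟩
    change a ⊗ₜ[F] (c : C) = _
    rw [hr, Algebra.algebraMap_eq_smul_one, TensorProduct.smul_tmul]
  | add x y hx hy =>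
    obtain ⟨a, ha⟩ := hx
    obtain ⟨b, hb⟩ := hy
    exact ⟨a + b, by rw [map_add, ha, hb, TensorProduct.add_tmul]⟩

theorem isCentral_tensorProduct (F S A C : Type*) [Field F] [Field S] [Algebra F S] [Ring A]
    [Algebra F A] [Algebra S A] [IsScalarTower F S A] [Algebra.IsCentral S A] [Ring C]
    [Nontrivial C] [Algebra F C] [Algebra.IsCentral F C] : Algebra.IsCentral S (A ⊗[F] C) := by
  refine ⟨fun z hz ↦ ?_⟩
  rw [Subalgebra.mem_center_iff] at hz
  obtain ⟨a, rfl⟩ := exists_eq_tmul_one_of_forall_commute fun c ↦ hz (1 ⊗ₜ c)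
  have hinj : Function.Injective (Algebra.TensorProduct.includeLeft : A →ₐ[F] A ⊗[F] C) :=
    Algebra.TensorProduct.includeLeft_injective (FaithfulSMul.algebraMap_injective F C)
  have ha : a ∈ Subalgebra.center S A := by
    rw [Subalgebra.mem_center_iff]
    intro b
    apply hinj
    simpa using hz (b ⊗ₜ 1)
  obtain ⟨s, hs⟩ := (Algebra.IsCentral.mem_center_iff S).1 ha
  exact ⟨s, by rw [hs]; rfl⟩

theorem isBrauerEquiv_baseChange_of_odd {F K K' L C : Type} [Field F] [Field K] [Field K']
    [Field L] [Algebra F K] [Algebra F K'] [Algebra F L] [Algebra K L] [Algebra K' L]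
    [IsScalarTower F K L] [IsScalarTower F K' L] [FiniteDimensional F K] [FiniteDimensional F K']
    [FiniteDimensional K' L] {j : ℕ} (hK : Module.finrank F K = 2 ^ j)
    (hL : Odd (Module.finrank K' L)) [Ring C] [Algebra F C] [FiniteDimensional F C]
    [IsSimpleRing C] [Algebra.IsCentral F C] (h : IsBrauerEquiv K (K ⊗[F] C) K) :
    IsBrauerEquiv K' (K' ⊗[F] C) K' := by
  have := IsArtinianRing.of_finite F C
  obtain ⟨r, hr, D, _, _, _, ⟨e⟩⟩ := IsSimpleRing.exists_algEquiv_matrix_divisionRing_finite F C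
  have : Algebra.IsCentral F D := by
    have := Algebra.IsCentral.of_algEquiv F _ _ (e.trans (matrixEquivTensor (Fin r) F D))
    exact Algebra.IsCentral.left_of_tensor_of_field F D (Matrix (Fin r) (Fin r) F)
  have hCD : IsBrauerEquiv F C D := .of_algEquiv_matrix e
  have hD : IsBrauerEquiv K (K ⊗[F] D) K := (hCD.symm.baseChange K).trans h
  obtain ⟨δ, hδ, hδK⟩ := exists_sq_eq_finrank_of_isBrauerEquiv hD
  have := isSimpleRing_tensorProduct F K' D
  have := IsArtinianRing.of_finite K' (K' ⊗[F] D)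
  obtain ⟨s, hs, D', _, _, _, ⟨e'⟩⟩ :=
    IsSimpleRing.exists_algEquiv_matrix_divisionRing_finite K' (K' ⊗[F] D)
  have hDD' : IsBrauerEquiv K' (K' ⊗[F] D) D' := .of_algEquiv_matrix e'
  have key : ∀ (M : Type) [Field M] [Algebra F M] [Algebra M L] [IsScalarTower F M L],
      IsBrauerEquiv L (L ⊗[M] (M ⊗[F] D)) (L ⊗[F] D) := fun M _ _ _ _ ↦
    .of_algEquiv <| (Algebra.TensorProduct.assoc F M L L M D).symm.trans <|
      Algebra.TensorProduct.congr (Algebra.TensorProduct.rid M L L) AlgEquiv.refl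
  have hL' : IsBrauerEquiv L (L ⊗[K'] D') L :=
    (hDD'.symm.baseChange L).trans <| (key K').trans <| (key K).symm.trans <|
      (hD.baseChange L).trans <| .of_algEquiv (Algebra.TensorProduct.rid K L L)
  obtain ⟨δ', hδ', hδL⟩ := exists_sq_eq_finrank_of_isBrauerEquiv hL'
  have hdim := e'.toLinearEquiv.finrank_eq
  rw [Module.finrank_matrix, Module.finrank_baseChange, hδ, hδ'] at hdim
  simp only [Fintype.card_fin] at hdim
  have hδδ : δ' ∣ δ := by
    rw [← Nat.pow_dvd_pow_iff two_ne_zero, hdim]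
    exact Dvd.intro_left _ rfl
  have h1 : δ' = 1 := by
    obtain ⟨a, -, ha⟩ := (Nat.dvd_prime_pow Nat.prime_two).1 (hK ▸ hδδ.trans hδK)
    rcases a with _ | a
    · simpa using ha
    · rw [ha] at hδL
      exact absurd (hL.of_dvd_nat hδL) (by simp [pow_succ])
  rw [h1, one_pow] at hδ'
  have hbij : Function.Bijective (Algebra.ofId K' D') :=
    ⟨(algebraMap K' D').injective, (LinearMap.injective_iff_surjective_of_finrank_eq_finrank
      (f := (Algebra.ofId K' D').toLinearMap) (by rw [hδ', Module.finrank_self])).1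
        (algebraMap K' D').injective⟩
  exact (hCD.baseChange K').trans <| hDD'.trans
    (IsBrauerEquiv.of_algEquiv (AlgEquiv.ofBijective _ hbij)).symm

theorem isBrauerEquiv_tensor_of_split_imp {F K K' B B₀ : Type} [Field F] [Field K] [Field K']
    [Algebra F K] [Algebra F K']
    [Ring B] [Algebra F B] [FiniteDimensional F B] [IsSimpleRing B] [Algebra.IsCentral F B]
    [Ring B₀] [Algebra F B₀] [FiniteDimensional F B₀] [IsSimpleRing B₀] [Algebra.IsCentral F B₀]
    (hsplit : ∀ (C : Type) [Ring C] [Algebra F C] [FiniteDimensional F C] [IsSimpleRing C]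
      [Algebra.IsCentral F C], IsBrauerEquiv K (K ⊗[F] C) K → IsBrauerEquiv K' (K' ⊗[F] C) K')
    (h : IsBrauerEquiv K (K ⊗[F] B) (K ⊗[F] B₀)) :
    IsBrauerEquiv K' (K' ⊗[F] B) (K' ⊗[F] B₀) := by
  obtain ⟨e⟩ := nonempty_tensor_op_algEquiv_matrix F B₀
  have : Nonempty (Fin (Module.finrank F B₀)) := Fin.pos_iff_nonempty.1 Module.finrank_pos
  have := isSimpleRing_tensorProduct F B B₀ᵐᵒᵖ
  have := isCentral_tensorProduct F F B B₀ᵐᵒᵖ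
  have h₁ : IsBrauerEquiv K (K ⊗[F] (B ⊗[F] B₀ᵐᵒᵖ)) K :=
    (IsBrauerEquiv.of_algEquiv (Algebra.TensorProduct.assoc F F K K B B₀ᵐᵒᵖ)).symm.trans <|
      (h.tensor_right B₀ᵐᵒᵖ).trans <|
      (IsBrauerEquiv.of_algEquiv (Algebra.TensorProduct.assoc F F K K B₀ B₀ᵐᵒᵖ)).trans <|
      IsBrauerEquiv.tensor_split K e
  have h₂ := (hsplit _ h₁).tensor_right (F := F) B₀
  refine IsBrauerEquiv.trans (IsBrauerEquiv.symm ?_) h₂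
  refine (IsBrauerEquiv.of_algEquiv ?_).trans
    (IsBrauerEquiv.tensor_split (K' ⊗[F] B) ((Algebra.TensorProduct.comm F _ _).trans e))
  exact (Algebra.TensorProduct.congr (Algebra.TensorProduct.assoc F F K' K' B B₀ᵐᵒᵖ).symm
    AlgEquiv.refl).trans <| Algebra.TensorProduct.assoc F F K' (K' ⊗[F] B) B₀ᵐᵒᵖ B₀

section

open Polynomial

theorem PadicInt.exists_root_of_dvd {r : ℕ} [Fact r.Prime] (F : ℤ_[r][X]) (a : ℤ_[r])
    (h₀ : (r : ℤ_[r]) ∣ F.eval a) (h₁ : ¬ (r : ℤ_[r]) ∣ F.derivative.eval a) :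
    ∃ z, F.eval z = 0 ∧ (r : ℤ_[r]) ∣ z - a := by
  rw [← PadicInt.norm_lt_one_iff_dvd] at h₀ h₁
  have h₁' : ‖F.derivative.eval a‖ = 1 := le_antisymm (PadicInt.norm_le_one _) (not_lt.1 h₁)
  obtain ⟨z, hz, hza, -⟩ := hensels_lemma (F := F) (a := a) (by simpa [h₁'] using h₀)
  simp only [coe_aeval_eq_eval, h₁'] at hz hza
  exact ⟨z, hz, by rwa [← PadicInt.norm_lt_one_iff_dvd]⟩

theorem PadicInt.natCast_dvd_intCast {r : ℕ} [Fact r.Prime] (a : ℤ) :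
    (r : ℤ_[r]) ∣ (a : ℤ_[r]) ↔ (r : ℤ) ∣ a := by
  rw [← PadicInt.norm_lt_one_iff_dvd, PadicInt.norm_int_lt_one_iff_dvd]

theorem Int.exists_dvd_sq_add_three {r : ℕ} (hr : r.Prime) (hr3 : r ≡ 1 [MOD 3]) :
    ∃ a : ℤ, (r : ℤ) ∣ a ^ 2 + 3 := by
  have := Fact.mk hr
  have h3 : 3 ∣ Fintype.card (ZMod r)ˣ := by
    rw [ZMod.card_units]
    exact (Nat.modEq_iff_dvd' hr.one_le).1 hr3.symm
  obtain ⟨u, hu⟩ := exists_prime_orderOf_dvd_card 3 h3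
  have hu1 : (u : ZMod r) ≠ 1 := by
    intro h
    rw [Units.val_eq_one.1 h, orderOf_one] at hu
    omega
  have hu3 : (u : ZMod r) ^ 3 = 1 := by
    have := pow_orderOf_eq_one u
    rw [hu] at this
    simpa using congrArg Units.val this
  have hq : (u : ZMod r) ^ 2 + u + 1 = 0 := by
    refine (mul_eq_zero.1 (?_ : ((u : ZMod r) - 1) * _ = 0)).resolve_left (sub_ne_zero.2 hu1)
    linear_combination hu3
  obtain ⟨a, ha⟩ := ZMod.intCast_surjective (2 * (u : ZMod r) + 1)
  refine ⟨a, (ZMod.intCast_zmod_eq_zero_iff_dvd _ _).1 ?_⟩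
  push_cast
  rw [ha]
  linear_combination 4 * hq

/-- `(x, y)` is a point of the tower `x ^ 4 + 6 x ^ 2 + 4 (4 M - 1) x - 3 = 0`, `y ^ 2 = c x`. -/
def IsTowerPoint (M : ℕ) (c : ℤ) {Ω : Type*} [Field Ω] (x y : Ω) : Prop :=
  x ^ 4 + 6 * x ^ 2 + (16 * M - 4) * x - 3 = 0 ∧ y ^ 2 = c * x

theorem IsTowerPoint.map {M : ℕ} {c : ℤ} {Ω Ω' : Type*} [Field Ω] [Field Ω'] {x y : Ω}
    (h : IsTowerPoint M c x y) (f : Ω →+* Ω') : IsTowerPoint M c (f x) (f y) := by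
  constructor
  · simpa only [map_sub, map_add, map_mul, map_pow, map_natCast, map_ofNat, map_zero] using
      congrArg f h.1
  · simpa using congrArg f h.2

theorem exists_isTowerPoint_padic {r M : ℕ} [hr : Fact r.Prime] (hr3 : r ≡ 1 [MOD 3])
    (hrM : r ∣ M) {c : ℤ} (hc : c = 1 ∨ c = -3) : ∃ x y : ℚ_[r], IsTowerPoint M c x y := by
  have hr7 : 5 ≤ r := by
    have := hr.out.two_le
    by_contra! h
    interval_cases r
    · exact absurd hr3 (by decide)
    · exact absurd hr3 (by decide)
    · exact absurd hr.out (by decide)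
  have h2 : ¬ (r : ℤ) ∣ 2 := fun h ↦ by have := Int.le_of_dvd (by norm_num) h; omega
  have h3 : ¬ (r : ℤ) ∣ 3 := fun h ↦ by have := Int.le_of_dvd (by norm_num) h; omega
  have hrp : Prime (r : ℤ) := Nat.prime_iff_prime_int.1 hr.out
  have h12 : ¬ (r : ℤ) ∣ 12 := fun h ↦ by
    rcases hrp.dvd_or_dvd (show (r : ℤ) ∣ 2 * (2 * 3) from h) with h | h
    · exact h2 h
    · rcases hrp.dvd_or_dvd h with h | h
      · exact h2 h
      · exact h3 h
  have hM : (r : ℤ_[r]) ∣ (M : ℤ_[r]) := by exact_mod_cast Nat.cast_dvd_cast hrM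
  obtain ⟨a, ha⟩ : ∃ a : ℤ, (r : ℤ) ∣ a ^ 2 - c := by
    rcases hc with rfl | rfl
    · exact ⟨1, by simp⟩
    · simpa using Int.exists_dvd_sq_add_three hr.out hr3
  have ha2 : ¬ (r : ℤ) ∣ 2 * a := fun h ↦ by
    rcases hrp.dvd_or_dvd h with h | h
    · exact h2 h
    · have : (r : ℤ) ∣ c := by
        rw [← dvd_sub_right (dvd_pow h two_ne_zero)]
        exact ha
      rcases hc with rfl | rfl
      · exact hrp.not_isUnit (isUnit_of_dvd_one this)
      · exact h3 (by simpa using this)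
  obtain ⟨x, hx, hx1⟩ := PadicInt.exists_root_of_dvd
    (X ^ 4 + 6 * X ^ 2 + (16 * (M : ℤ_[r][X]) - 4) * X - 3) 1
    (by
      simp only [eval_add, eval_sub, eval_mul, eval_pow, eval_X, eval_natCast, eval_ofNat]
      obtain ⟨t, ht⟩ := hM
      exact ⟨16 * t, by rw [ht]; ring⟩)
    (by
      intro h
      simp only [derivative_add, derivative_sub, derivative_mul, derivative_X_pow, derivative_X,
        derivative_natCast, derivative_ofNat, eval_add, eval_sub, eval_mul, eval_pow, eval_X,
        eval_natCast, eval_ofNat, eval_C, eval_zero, eval_one] at h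
      apply h12
      rw [← PadicInt.natCast_dvd_intCast]
      rw [← dvd_add_left (hM.mul_left 16)]
      convert h using 1
      push_cast
      ring)
  obtain ⟨y, hy, -⟩ := PadicInt.exists_root_of_dvd
    (X ^ 2 - C ((c : ℤ_[r]) * x)) (a : ℤ_[r])
    (by
      simp only [eval_sub, eval_pow, eval_X, eval_C]
      have h : (r : ℤ_[r]) ∣ ((a ^ 2 - c : ℤ) : ℤ_[r]) := (PadicInt.natCast_dvd_intCast _).2 ha
      have := dvd_sub h (hx1.mul_left (c : ℤ_[r]))
      convert this using 1
      push_cast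
      ring)
    (by
      intro h
      apply ha2
      rw [← PadicInt.natCast_dvd_intCast]
      simpa [one_add_one_eq_two] using h)
  refine ⟨x, y, ?_, ?_⟩
  · simp only [eval_add, eval_sub, eval_mul, eval_pow, eval_X, eval_natCast, eval_ofNat] at hx
    exact_mod_cast congrArg (fun t : ℤ_[r] ↦ (t : ℚ_[r])) hx
  · simpa [sub_eq_zero] using congrArg (fun t : ℤ_[r] ↦ (t : ℚ_[r])) hy

theorem exists_pow_two_pow_eq_padic {p l : ℕ} [hp : Fact p.Prime] (hp2 : p ≠ 2)
    (hl : l ≡ 1 [MOD p]) (i : ℕ) : ∃ m : ℚ_[p], m ^ 2 ^ i = l := by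
  obtain ⟨m, hm, -⟩ := PadicInt.exists_root_of_dvd (X ^ 2 ^ i - (l : ℤ_[p][X])) 1
    (by
      simp only [eval_sub, eval_pow, eval_X, eval_natCast, one_pow]
      have := (PadicInt.natCast_dvd_intCast (r := p) (1 - l)).2 (Nat.modEq_iff_dvd.1 hl)
      simpa using this)
    (by
      have h : ¬ (p : ℤ) ∣ ((2 ^ i : ℕ) : ℤ) := by
        rw [Int.natCast_dvd_natCast]
        intro h
        exact hp2 ((Nat.prime_dvd_prime_iff_eq hp.out Nat.prime_two).1 (hp.out.dvd_of_dvd_pow h))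
      rw [← PadicInt.natCast_dvd_intCast] at h
      simpa [derivative_X_pow] using h)
  refine ⟨m, ?_⟩
  simpa [sub_eq_zero] using congrArg (fun t : ℤ_[p] ↦ (t : ℚ_[p])) hm

theorem exists_isTowerPoint_real (M : ℕ) : ∃ x y : ℝ, IsTowerPoint M (-3) x y := by
  obtain ⟨x, hx, hx0⟩ : ∃ x ∈ Set.Icc (-(16 * M + 4) : ℝ) 0,
      x ^ 4 + 6 * x ^ 2 + (16 * M - 4) * x - 3 = 0 := by
    have hM : (0 : ℝ) ≤ M := M.cast_nonneg
    refine intermediate_value_Icc' (f := fun x : ℝ ↦ x ^ 4 + 6 * x ^ 2 + (16 * M - 4) * x - 3)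
      (by linarith) (by fun_prop) ⟨by norm_num, ?_⟩
    have : (0 : ℝ) ≤ (16 * M + 4) ^ 2 * ((16 * M + 4) ^ 2 - 1) := by
      apply mul_nonneg (by positivity)
      nlinarith
    nlinarith
  refine ⟨x, √(-3 * x), hx0, ?_⟩
  rw [Real.sq_sqrt (by linarith [hx.2])]
  norm_num

theorem Polynomial.exists_irreducible_dvd_of_odd_natDegree {F : Type*} [Field F] (f : F[X])
    (hf : Odd f.natDegree) : ∃ h : F[X], Irreducible h ∧ h ∣ f ∧ Odd h.natDegree := by
  induction f using WfDvdMonoid.induction_on_irreducible with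
  | zero => simp at hf
  | unit u hu => simp [natDegree_eq_zero_of_isUnit hu] at hf
  | mul a i ha hi ih =>
    rw [natDegree_mul hi.ne_zero ha] at hf
    by_cases h : Odd i.natDegree
    · exact ⟨i, hi, dvd_mul_right _ _, h⟩
    · obtain ⟨t, ht, hta, hto⟩ := ih (by
        rw [Nat.odd_add] at hf
        by_contra h'
        exact h (hf.2 (Nat.not_odd_iff_even.1 h')))
      exact ⟨t, ht, hta.mul_left _, hto⟩

/-- The quartic `X ^ 4 + 6 X ^ 2 + 4 (4 M - 1) X - 3`. -/
noncomputable def towerQuartic (M : ℕ) (R : Type*) [CommRing R] : R[X] :=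
  X ^ 4 + C 6 * X ^ 2 + C (16 * (M : R) - 4) * X + C (-3)

theorem towerQuartic_map (M : ℕ) {R S : Type*} [CommRing R] [CommRing S] (f : R →+* S) :
    (towerQuartic M R).map f = towerQuartic M S := by
  simp [towerQuartic, map_ofNat]

theorem towerQuartic_eval₂ (M : ℕ) {R S : Type*} [CommRing R] [CommRing S] (f : R →+* S) (x : S) :
    (towerQuartic M R).eval₂ f x = x ^ 4 + 6 * x ^ 2 + (16 * M - 4) * x - 3 := by
  rw [← eval_map, towerQuartic_map]
  simp [towerQuartic, sub_eq_add_neg]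

theorem towerQuartic_natDegree (M : ℕ) (R : Type*) [CommRing R] [Nontrivial R] :
    (towerQuartic M R).natDegree = 4 := by
  unfold towerQuartic
  compute_degree!

theorem towerQuartic_monic (M : ℕ) (R : Type*) [CommRing R] [Nontrivial R] :
    (towerQuartic M R).Monic := by
  unfold towerQuartic
  monicity!

theorem towerQuartic_irreducible {M : ℕ} (hM : M ≡ 1 [MOD 3]) :
    Irreducible (towerQuartic M ℚ) := by
  have h3 : (Ideal.span {(3 : ℤ)}).IsPrime :=
    (Ideal.span_singleton_prime (by norm_num)).2 Int.prime_three
  have hmon := towerQuartic_monic M ℤ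
  have hdeg := towerQuartic_natDegree M ℤ
  have hirr : Irreducible (towerQuartic M ℤ) := by
    refine irreducible_of_eisenstein_criterion h3 ?_ ?_ ?_ ?_ hmon.isPrimitive
    · rw [hmon.leadingCoeff, Ideal.mem_span_singleton]
      norm_num
    · intro n hn
      have hn4 : n < 4 := by
        have := hn.trans_le degree_le_natDegree
        rw [hdeg] at this
        exact_mod_cast this
      rw [Ideal.mem_span_singleton]
      have h16 : (3 : ℤ) ∣ 16 * (M : ℤ) - 4 := by
        have : M % 3 = 1 := hM
        omega
      interval_cases n <;> simp [towerQuartic, coeff_X, coeff_X_pow, -eq_intCast, coeff_C]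
      exact h16
    · rw [← natDegree_pos_iff_degree_pos, hdeg]
      norm_num
    · rw [Ideal.span_singleton_pow, Ideal.mem_span_singleton]
      simp [towerQuartic]
  have := (IsPrimitive.Int.irreducible_iff_irreducible_map_cast hmon.isPrimitive).1 hirr
  rwa [towerQuartic_map] at this

theorem X_pow_two_pow_sub_C_irreducible_padic (l : ℕ) [hl : Fact l.Prime] {n : ℕ} (hn : n ≠ 0) :
    Irreducible (X ^ n - C (l : ℚ_[l])) := by
  have hmon : (X ^ n - C (l : ℤ_[l])).Monic := monic_X_pow_sub_C _ hn
  have hl' : Prime (l : ℤ_[l]) := PadicInt.prime_p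
  have hirr : Irreducible (X ^ n - C (l : ℤ_[l])) := by
    refine irreducible_of_eisenstein_criterion
      ((Ideal.span_singleton_prime hl'.ne_zero).2 hl') ?_ ?_ ?_ ?_ hmon.isPrimitive
    · rw [hmon.leadingCoeff, Ideal.mem_span_singleton]
      exact fun h ↦ hl'.not_isUnit (isUnit_of_dvd_one h)
    · intro k hk
      rw [degree_X_pow_sub_C (Nat.pos_of_ne_zero hn)] at hk
      have hk' : k ≠ n := (Nat.cast_lt.1 hk).ne
      rw [Ideal.mem_span_singleton, coeff_sub, coeff_X_pow, if_neg hk', coeff_C, zero_sub, dvd_neg]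
      split_ifs <;> simp
    · rw [degree_X_pow_sub_C (Nat.pos_of_ne_zero hn)]
      exact_mod_cast Nat.pos_of_ne_zero hn
    · rw [Ideal.span_singleton_pow, Ideal.mem_span_singleton]
      simp only [coeff_sub, coeff_X_pow, hn.symm, if_false, coeff_C_zero, zero_sub, dvd_neg]
      rintro ⟨t, ht⟩
      apply hl'.not_isUnit
      refine IsUnit.of_mul_eq_one t (mul_left_cancel₀ hl'.ne_zero ?_)
      rw [mul_one, ← mul_assoc, ← pow_two, ← ht]
  have := (hmon.irreducible_iff_irreducible_map_fraction_map (K := ℚ_[l])).1 hirr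
  simpa using this

theorem not_isSquare_mul_root {M : ℕ} [Fact (Irreducible (towerQuartic M ℚ))] {c : ℤ}
    (hc : c ≠ 0) (b : AdjoinRoot (towerQuartic M ℚ)) :
    b ^ 2 ≠ c * AdjoinRoot.root (towerQuartic M ℚ) := by
  intro h
  have hmon := towerQuartic_monic M ℚ
  let pb := AdjoinRoot.powerBasis hmon.ne_zero
  have : FiniteDimensional ℚ (AdjoinRoot (towerQuartic M ℚ)) := pb.finite
  have hdim : pb.dim = 4 := towerQuartic_natDegree M ℚ
  have hN : Algebra.norm ℚ (AdjoinRoot.root (towerQuartic M ℚ)) = -3 := by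
    have := Algebra.PowerBasis.norm_gen_eq_coeff_zero_minpoly pb
    rw [AdjoinRoot.minpoly_powerBasis_gen_of_monic hmon] at this
    change Algebra.norm ℚ (AdjoinRoot.root (towerQuartic M ℚ)) = _ at this
    rw [this, hdim]
    norm_num [towerQuartic]
  have h' := congrArg (Algebra.norm ℚ) h
  have hcm : (c : AdjoinRoot (towerQuartic M ℚ)) = algebraMap ℚ _ (c : ℚ) := by simp
  rw [map_pow, map_mul, hN, hcm, Algebra.norm_algebraMap, pb.finrank, hdim] at h'
  have hc' : (0 : ℚ) < (c : ℚ) ^ 4 := by positivity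
  nlinarith [sq_nonneg (Algebra.norm ℚ b)]

theorem NumField.exists_adjoinRoot (k : NumField) {P : k.carrier[X]} (hP : Irreducible P) :
    ∃ N : NumField, Module.finrank ℚ N.carrier = Module.finrank ℚ k.carrier * P.natDegree ∧
      ∃ (f : k.carrier →+* N.carrier) (r : N.carrier), P.eval₂ f r = 0 ∧
        ∀ (Ω : Type) [Field Ω] (g : k.carrier →+* Ω) (s : Ω), P.eval₂ g s = 0 →
          Nonempty (N.carrier →+* Ω) := by
  have := Fact.mk hP
  let pb := AdjoinRoot.powerBasis hP.ne_zero
  have : CharZero (AdjoinRoot P) :=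
    charZero_of_injective_algebraMap (algebraMap k.carrier (AdjoinRoot P)).injective
  have : FiniteDimensional k.carrier (AdjoinRoot P) := pb.finite
  have : IsScalarTower ℚ k.carrier (AdjoinRoot P) := inferInstance
  have : FiniteDimensional ℚ (AdjoinRoot P) := Module.Finite.trans k.carrier _
  have hdeg : Module.finrank ℚ (AdjoinRoot P) = Module.finrank ℚ k.carrier * P.natDegree := by
    rw [← Module.finrank_mul_finrank ℚ k.carrier, pb.finrank]
    rfl
  have hNF : NumberField (AdjoinRoot P) := { to_finiteDimensional := by convert this }
  refine ⟨⟨AdjoinRoot P⟩, ?_, AdjoinRoot.of P, AdjoinRoot.root P, AdjoinRoot.eval₂_root P,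
    fun Ω _ g s h ↦ ⟨AdjoinRoot.lift g s h⟩⟩
  convert hdeg

theorem exists_tower {M l : ℕ} [hl : Fact l.Prime] (hM : M ≡ 1 [MOD 3]) (hl3 : l ≡ 1 [MOD 3])
    (hlM : l ∣ M) {c : ℤ} (hc : c = 1 ∨ c = -3) (i : ℕ) :
    ∃ N : NumField, Module.finrank ℚ N.carrier = 2 ^ (i + 3) ∧
      (∃ x y m : N.carrier, IsTowerPoint M c x y ∧ m ^ 2 ^ i = l) ∧
      ∀ (Ω : Type) [Field Ω] [CharZero Ω] (x y m : Ω), IsTowerPoint M c x y → m ^ 2 ^ i = l →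
        Nonempty (N.carrier →+* Ω) := by
  have hc0 : c ≠ 0 := by rcases hc with rfl | rfl <;> norm_num
  have hi : 2 ^ i ≠ 0 := by positivity
  have := Fact.mk (towerQuartic_irreducible hM)
  let pb := AdjoinRoot.powerBasis (towerQuartic_monic M ℚ).ne_zero
  have hfin : FiniteDimensional ℚ (AdjoinRoot (towerQuartic M ℚ)) := pb.finite
  have hdeg : Module.finrank ℚ (AdjoinRoot (towerQuartic M ℚ)) = 4 := by
    rw [pb.finrank]
    exact towerQuartic_natDegree M ℚ
  have hNF : NumberField (AdjoinRoot (towerQuartic M ℚ)) :=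
    { to_charZero := charZero_of_injective_algebraMap (algebraMap ℚ _).injective
      to_finiteDimensional := by convert hfin }
  let k : NumField := ⟨AdjoinRoot (towerQuartic M ℚ)⟩
  have hk : Module.finrank ℚ k.carrier = 4 := by
    convert hdeg
  let x : k.carrier := AdjoinRoot.root (towerQuartic M ℚ)
  obtain ⟨K, hK, f₁, y, hy, lift₁⟩ := k.exists_adjoinRoot (P := X ^ 2 - C ((c : k.carrier) * x))
    (X_pow_sub_C_irreducible_of_prime Nat.prime_two (not_isSquare_mul_root hc0))
  have lift₁' : ∀ (Ω : Type) [Field Ω] [CharZero Ω] (x y : Ω), IsTowerPoint M c x y →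
      Nonempty (K.carrier →+* Ω) := by
    intro Ω _ _ x' y' h
    let f : AdjoinRoot (towerQuartic M ℚ) →+* Ω := AdjoinRoot.lift (algebraMap ℚ Ω) x'
      (by rw [towerQuartic_eval₂]; exact h.1)
    have hf : f x = x' := AdjoinRoot.lift_root _
    refine lift₁ Ω f y' ?_
    rw [eval₂_sub, eval₂_X_pow, eval₂_C, map_mul, map_intCast]
    exact sub_eq_zero.2 (by rw [h.2]; exact congrArg _ hf.symm)
  obtain ⟨N, hN, f₂, m, hm, lift₂⟩ := K.exists_adjoinRoot (P := X ^ 2 ^ i - C (l : K.carrier)) (by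
    obtain ⟨x', y', h⟩ := exists_isTowerPoint_padic hl3 hlM hc
    obtain ⟨f⟩ := lift₁' _ x' y' h
    refine (monic_X_pow_sub_C _ hi).irreducible_of_irreducible_map f _ ?_
    simpa using X_pow_two_pow_sub_C_irreducible_padic l hi)
  refine ⟨N, ?_, ⟨f₂ (f₁ x), f₂ y, m, ⟨?_, ?_⟩, ?_⟩, fun Ω _ _ x' y' m' h hm' ↦ ?_⟩
  · rw [hN, hK, hk, natDegree_X_pow_sub_C, natDegree_X_pow_sub_C]
    ring
  · have hx := (towerQuartic_eval₂ M (AdjoinRoot.of (towerQuartic M ℚ)) x).symm.trans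
      (AdjoinRoot.eval₂_root _)
    have hfx := congrArg (f₂.comp f₁) hx
    simp only [map_sub, map_add, map_mul, map_pow, map_natCast, map_ofNat, map_zero] at hfx
    exact hfx
  · rw [eval₂_sub, eval₂_X_pow, eval₂_C, map_mul, map_intCast, sub_eq_zero] at hy
    simpa using congrArg f₂ hy
  · rw [eval₂_sub, eval₂_X_pow, eval₂_C, map_natCast, sub_eq_zero] at hm
    exact hm
  · obtain ⟨g⟩ := lift₁' Ω x' y' h
    exact lift₂ Ω g m' (by simp [hm'])

/-- The discriminant identity for the quartic `X ^ 4 + 6 X ^ 2 + k X - 3`, in terms of the sum `s`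
and the product `p` of two of its roots and the product `q` of the two remaining ones. -/
theorem quartic_discr_identity {R : Type*} [CommRing R] {p q s k : R} (h₁ : p * q = -3)
    (h₂ : p + q - s ^ 2 = 6) (h₃ : s * (p - q) = k) :
    (p - 3) ^ 2 * (s ^ 2 - 4 * p) * (2 * s ^ 2 * (p + q) + (q - p) ^ 2) ^ 2 =
      -3 * p * (3 * (k ^ 2 + 64)) ^ 2 := by
  have hS : s ^ 2 = p + q - 6 := by linear_combination -h₂
  rw [← h₃, mul_pow s, hS]
  linear_combination (-2592 * q ^ 2 + 1728 * q ^ 3 - 378 * q ^ 4 + 27 * q ^ 5 + 36864 * p -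
    5184 * p * q - 3456 * p * q ^ 2 + 936 * p * q ^ 3 - 45 * p * q ^ 4 - 2592 * p ^ 2 +
    4992 * p ^ 2 * q - 540 * p ^ 2 * q ^ 2 - 42 * p ^ 2 * q ^ 3 - 5184 * p ^ 3 - 216 * p ^ 3 * q +
    94 * p ^ 3 * q ^ 2 + 1350 * p ^ 4 - 81 * p ^ 4 * q - 81 * p ^ 5) * h₁

theorem IsTowerPoint.exists_odd_extension {N : Type} [Field N] [CharZero N] {M : ℕ} {c c' : ℤ}
    (hc : c * c' = -3) {x y : N} (h : IsTowerPoint M c x y) :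
    ∃ (L : Type) (_ : Field L) (_ : Algebra N L), FiniteDimensional N L ∧
      Odd (Module.finrank N L) ∧ ∃ x' y' : L, IsTowerPoint M c' x' y' := by
  let P : N[X] := X ^ 3 + C x * X ^ 2 + C (6 + x ^ 2) * X + C (x ^ 3 + 6 * x + (16 * M - 4))
  have hP : P.natDegree = 3 := by
    simp only [P]
    compute_degree!
  obtain ⟨t, ht, htP, hodd⟩ := P.exists_irreducible_dvd_of_odd_natDegree (by rw [hP]; decide)
  have := Fact.mk ht
  let pb := AdjoinRoot.powerBasis ht.ne_zero
  have : CharZero (AdjoinRoot t) :=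
    charZero_of_injective_algebraMap (algebraMap N (AdjoinRoot t)).injective
  refine ⟨AdjoinRoot t, inferInstance, inferInstance, pb.finite, by rwa [pb.finrank], ?_⟩
  have hcq : (c : AdjoinRoot t) * c' = -3 := by exact_mod_cast hc
  obtain ⟨hx, hy⟩ := h.map (AdjoinRoot.of t)
  generalize AdjoinRoot.of t y = b at hy
  have hr : P.eval₂ (AdjoinRoot.of t) (AdjoinRoot.root t) = 0 :=
    eval₂_eq_zero_of_dvd_of_eval₂_eq_zero _ _ htP (AdjoinRoot.eval₂_root t)
  simp only [P, eval₂_add, eval₂_mul, eval₂_pow, eval₂_X, eval₂_C] at hr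
  simp only [map_add, map_sub, map_mul,
    map_pow, map_natCast, map_ofNat] at hr
  generalize AdjoinRoot.of t x = a at hx hy hr
  generalize AdjoinRoot.root t = r at hr
  have hx' : r ^ 4 + 6 * r ^ 2 + (16 * M - 4) * r - 3 = 0 := by
    linear_combination hx + (r - a) * hr
  have ha : a ≠ 0 := by
    rintro rfl
    norm_num at hx
  have hc0 : (c : AdjoinRoot t) ≠ 0 := by
    intro h0
    rw [h0, zero_mul] at hcq
    norm_num at hcq
  have hb : b ≠ 0 := by
    rintro rfl
    have := mul_ne_zero hc0 ha
    exact this (by rw [← hy]; ring)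
  set k : AdjoinRoot t := 16 * M - 4 with hk
  have hk0 : 3 * (k ^ 2 + 64) ≠ 0 := by
    have : (3 * ((16 * M - 4) ^ 2 + 64) : ℤ) ≠ 0 := by positivity
    rw [hk]
    exact_mod_cast this
  have key := quartic_discr_identity (p := a * r) (q := 6 + (a + r) ^ 2 - a * r) (s := a + r)
    (k := k) (by linear_combination a * hr - hx) (by ring) (by linear_combination -hr)
  refine ⟨r, (a * r - 3) * (a - r) * (2 * (a + r) ^ 2 * (a * r + (6 + (a + r) ^ 2 - a * r)) +
    (6 + (a + r) ^ 2 - a * r - a * r) ^ 2) / (3 * (k ^ 2 + 64) * b), hx', ?_⟩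
  rw [div_pow, div_eq_iff (pow_ne_zero 2 (mul_ne_zero hk0 hb))]
  rw [mul_pow _ b, hy]
  linear_combination key - a * r * (3 * (k ^ 2 + 64)) ^ 2 * hcq

theorem IsTowerPoint.exists_cube_eq {N : Type} [Field N] [CharZero N] {M : ℕ} {c c' : ℤ}
    {x y x' y' : N} (h : IsTowerPoint M c x y) (h' : IsTowerPoint M c' x' y') (hne : x ≠ x') :
    ∃ T : N, T ^ 3 = 2 * ((4 * M - 1) ^ 2 + 4) := by
  have hx := h.1
  have hx' := h'.1
  have hh : (x + x') * (x ^ 2 + x' ^ 2) + 6 * (x + x') + (16 * M - 4) = 0 := by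
    apply mul_left_cancel₀ (sub_ne_zero.2 hne)
    linear_combination hx - hx'
  refine ⟨((x + x') ^ 2 + 4) / 2, ?_⟩
  have hpq : x * x' * (6 + (x + x') ^ 2 - x * x') = -3 := by
    linear_combination x * hh - hx
  rw [div_pow, div_eq_iff (by norm_num)]
  have hs : (x + x') * (2 * x * x' - 6 - (x + x') ^ 2) = 16 * M - 4 := by
    linear_combination -hh
  have h16 : (16 : N) * ((4 * M - 1) ^ 2 + 4) = (16 * M - 4) ^ 2 + 64 := by ring
  rw [mul_right_comm, show (2 : N) * 2 ^ 3 = 16 by norm_num, h16, ← hs]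
  linear_combination (4 * (x + x') ^ 2) * hpq

theorem two_mul_not_cube {M : ℕ} (hM : M ≠ 0) (b : ℚ) :
    b ^ 3 ≠ 2 * ((4 * M - 1) ^ 2 + 4) := by
  intro h
  obtain ⟨t, rfl⟩ := Nat.exists_eq_succ_of_ne_zero hM
  have hb : b ^ 3 = ((2 * ((4 * t + 3) ^ 2 + 4) : ℕ) : ℚ) := by
    rw [h]
    push_cast
    ring
  have hv := congrArg (padicValRat 2) hb
  have hodd : ¬ 2 ∣ (4 * t + 3) ^ 2 + 4 := by
    rw [Nat.two_dvd_ne_zero, ← Nat.odd_iff]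
    have : Odd (4 * t + 3) := ⟨2 * t + 1, by ring⟩
    exact (this.pow).add_even (by decide)
  rw [padicValRat.pow, padicValRat.of_nat, padicValNat.mul two_ne_zero (by positivity),
    padicValNat.self one_lt_two, padicValNat.eq_zero_of_not_dvd hodd] at hv
  push_cast at hv
  omega

theorem isEmpty_ringEquiv_of_isTowerPoint {N N' : NumField} {n M : ℕ} (hM : M ≠ 0)
    (hN' : Module.finrank ℚ N'.carrier = 2 ^ n) {x y : N.carrier} (h : IsTowerPoint M 1 x y)
    {x' y' : N'.carrier} (h' : IsTowerPoint M (-3) x' y') (f : N'.carrier →+* ℝ) :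
    IsEmpty (N.carrier ≃+* N'.carrier) := by
  refine ⟨fun e ↦ ?_⟩
  have he := h.map e.toRingHom
  by_cases hne : e.toRingHom x = x'
  · obtain ⟨-, hy⟩ := he.map f
    obtain ⟨hx', hy'⟩ := h'.map f
    rw [hne] at hy
    have h0 : f x' = 0 := by
      push_cast at hy hy'
      nlinarith [sq_nonneg (f y'), sq_nonneg (f (e.toRingHom y))]
    rw [h0] at hx'
    norm_num at hx'
  · obtain ⟨T, hT⟩ := he.exists_cube_eq h' hne
    have hirr := X_pow_sub_C_irreducible_of_prime Nat.prime_three (two_mul_not_cube hM)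
    have hmin := minpoly.eq_of_irreducible_of_monic hirr (x := T) (by simp [hT])
      (monic_X_pow_sub_C _ three_ne_zero)
    have hdvd := minpoly.degree_dvd (K := ℚ) (x := T) (Algebra.IsIntegral.isIntegral T)
    rw [← hmin, natDegree_X_pow_sub_C, hN'] at hdvd
    exact absurd (Nat.prime_three.dvd_of_dvd_pow hdvd) (by decide)

end

/-- The weight of a row of the twisted companion matrix: `π` in row `0`, and `1` elsewhere. -/
def companionWeight {d : ℕ} [NeZero d] {K : Type*} [One K] (π : K) (k : Fin d) : K :=
  if k = 0 then π else 1

/-- The companion matrix of `X ^ d - π`. -/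
def companionPower (d : ℕ) [NeZero d] {K : Type*} [Zero K] [One K] (π : K) :
    Matrix (Fin d) (Fin d) K :=
  Matrix.of fun k l => if l + 1 = k then companionWeight π k else 0

section companionPower

variable {d : ℕ} [NeZero d] {K : Type*} [Field K]

lemma companionPower_mul_apply (π : K) (M : Matrix (Fin d) (Fin d) K) (k l : Fin d) :
    (companionPower d π * M) (k + 1) l = companionWeight π (k + 1) * M k l := by
  rw [Matrix.mul_apply, Finset.sum_eq_single k]
  · simp [companionPower]
  · intro b _ hb
    simp [companionPower, hb]
  · simp

lemma mul_companionPower_apply (π : K) (M : Matrix (Fin d) (Fin d) K) (k l : Fin d) :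
    (M * companionPower d π) k l = M k (l + 1) * companionWeight π (l + 1) := by
  rw [Matrix.mul_apply, Finset.sum_eq_single (l + 1)]
  · simp [companionPower]
  · intro b _ hb
    simp [companionPower, hb.symm]
  · simp

lemma companionWeight_ne_zero {π : K} (hπ : π ≠ 0) (k : Fin d) : companionWeight π k ≠ 0 := by
  unfold companionWeight
  split_ifs <;> simp [hπ]

lemma map_companionPower {L : Type*} [Field L] (f : K →+* L) (π : K) :
    (companionPower d π).map f = companionPower d (f π) := by
  ext k l
  simp only [companionPower, companionWeight, Matrix.map_apply, Matrix.of_apply]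
  split_ifs <;> simp

/-- The matrices `M` with `P φ(M) = M P`, for `P` the companion matrix of `X ^ d - π`. -/
def twistedCentralizer (d : ℕ) [NeZero d] (φ : K →+* K) (π : K) :
    Subring (Matrix (Fin d) (Fin d) K) where
  carrier := {M | companionPower d π * M.map φ = M * companionPower d π}
  mul_mem' {M N} hM hN := by
    simp only [Set.mem_ofPred_eq] at *
    rw [Matrix.map_mul, ← mul_assoc, hM, mul_assoc, hN, mul_assoc]
  one_mem' := by simp
  add_mem' {M N} hM hN := by
    simp only [Set.mem_ofPred_eq] at *
    rw [Matrix.map_add _ (map_add φ), mul_add, hM, hN, add_mul]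
  zero_mem' := by simp
  neg_mem' {M} hM := by
    simp only [Set.mem_ofPred_eq] at *
    have : (-M).map φ = -(M.map φ) := by ext; simp
    rw [this, mul_neg, hM, neg_mul]

lemma mem_twistedCentralizer {φ : K →+* K} {π : K} {M : Matrix (Fin d) (Fin d) K} :
    M ∈ twistedCentralizer d φ π ↔
      companionPower d π * M.map φ = M * companionPower d π := Iff.rfl

lemma mem_twistedCentralizer_iff_apply {φ : K →+* K} {π : K} {M : Matrix (Fin d) (Fin d) K} :
    M ∈ twistedCentralizer d φ π ↔ ∀ k l : Fin d,
      companionWeight π (k + 1) * φ (M k l) = M (k + 1) (l + 1) * companionWeight π (l + 1) := by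
  rw [mem_twistedCentralizer]
  constructor
  · intro h k l
    have := congrFun (congrFun h (k + 1)) l
    rwa [companionPower_mul_apply, mul_companionPower_apply, Matrix.map_apply] at this
  · intro h
    ext k l
    obtain ⟨k, rfl⟩ : ∃ k', k = k' + 1 := ⟨k - 1, by simp⟩
    rw [companionPower_mul_apply, mul_companionPower_apply, Matrix.map_apply, h]

lemma Fin.add_one_lt_add_one_iff_of_ne_zero {k l : Fin d} (hl : l + 1 ≠ 0) :
    k + 1 < l + 1 ↔ k < l ∨ k + 1 = 0 := by
  obtain ⟨n, rfl⟩ : ∃ n, d = n + 1 := ⟨d - 1, (Nat.succ_pred (NeZero.ne d)).symm⟩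
  have hl' : l ≠ Fin.last n := by rintro rfl; simp at hl
  have hlv : (l : ℕ) < n := by
    have := l.is_lt; have : (l : ℕ) ≠ n := fun h => hl' (Fin.ext h); omega
  have h1 : ((l + 1 : Fin (n + 1)) : ℕ) = l + 1 := Fin.val_add_one_of_lt (Fin.lt_def.2 hlv)
  by_cases hk : k = Fin.last n
  · subst hk
    simp [Fin.pos_iff_ne_zero, hl]
  · have hkv : (k : ℕ) < n := by
      have := k.is_lt; have : (k : ℕ) ≠ n := fun h => hk (Fin.ext h); omega
    have h2 : ((k + 1 : Fin (n + 1)) : ℕ) = k + 1 := Fin.val_add_one_of_lt (Fin.lt_def.2 hkv)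
    rw [Fin.lt_def, Fin.lt_def, h1, h2]
    have : k + 1 ≠ 0 := by
      intro h; rw [h] at h2; simp at h2
    simp [this]

/-- The matrix in the twisted centralizer with first column `c`. -/
def twistedMatrix (φ : K →+* K) (π : K) (c : Fin d → K) : Matrix (Fin d) (Fin d) K :=
  Matrix.of fun k l => φ^[l] (c (k - l)) * if k < l then π else 1

lemma twistedMatrix_add_one_add_one {φ : K →+* K} {π : K} (hπ : φ π = π) (c : Fin d → K)
    (k l : Fin d) (hl : l + 1 ≠ 0) :
    twistedMatrix φ π c (k + 1) (l + 1) =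
      companionWeight π (k + 1) * φ (twistedMatrix φ π c k l) := by
  obtain ⟨n, rfl⟩ : ∃ n, d = n + 1 := ⟨d - 1, (Nat.succ_pred (NeZero.ne d)).symm⟩
  have hl' : l ≠ Fin.last n := by rintro rfl; simp at hl
  have h1 : ((l + 1 : Fin (n + 1)) : ℕ) = l + 1 := Fin.val_add_one_of_lt
    (lt_of_le_of_ne (Fin.le_last _) hl')
  simp only [twistedMatrix, Matrix.of_apply, h1, add_sub_add_right_eq_sub,
    Function.iterate_succ_apply', map_mul, Fin.add_one_lt_add_one_iff_of_ne_zero hl,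
    companionWeight]
  by_cases hk : k + 1 = 0
  · have : ¬ k < l := by
      have : k = Fin.last n := by
        rw [← Fin.last_add_one n] at hk; exact add_right_cancel hk
      rw [this]; exact not_lt.2 (Fin.le_last _)
    simp [hk, this, mul_comm]
  · by_cases hkl : k < l <;> simp [hk, hkl, hπ]

lemma eq_twistedMatrix_of_mem {φ : K →+* K} {π : K} (hπ : φ π = π)
    {M : Matrix (Fin d) (Fin d) K} (hM : M ∈ twistedCentralizer d φ π) :
    M = twistedMatrix φ π fun k => M k 0 := by
  rw [mem_twistedCentralizer_iff_apply] at hM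
  have key : ∀ (n : ℕ) (hn : n < d) (k : Fin d),
      M k ⟨n, hn⟩ = twistedMatrix φ π (fun k => M k 0) k ⟨n, hn⟩ := by
    intro n
    induction n with
    | zero =>
      intro hn k
      have : (⟨0, hn⟩ : Fin d) = 0 := rfl
      simp [this, twistedMatrix]
    | succ n ih =>
      intro hn k
      have h1 : (⟨n + 1, hn⟩ : Fin d) = ⟨n, by omega⟩ + 1 := by
        ext
        simp [Fin.val_add, Nat.mod_eq_of_lt hn]
      have h0 : (⟨n, by omega⟩ : Fin d) + 1 ≠ 0 := by
        rw [← h1]; intro h; simpa using congrArg Fin.val h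
      obtain ⟨k, rfl⟩ : ∃ k', k = k' + 1 := ⟨k - 1, by simp⟩
      rw [h1, twistedMatrix_add_one_add_one hπ _ _ _ h0, ← ih]
      have := hM k ⟨n, by omega⟩
      rw [this, companionWeight, if_neg h0, mul_one]
  ext k l
  exact key l l.is_lt k

lemma twistedMatrix_mem {φ : K →+* K} {π : K} (hπ : φ π = π) (hφ : ∀ x, φ^[d] x = x)
    (c : Fin d → K) : twistedMatrix φ π c ∈ twistedCentralizer d φ π := by
  rw [mem_twistedCentralizer_iff_apply]
  intro k l
  by_cases hl : l + 1 = 0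
  · obtain ⟨n, rfl⟩ : ∃ n, d = n + 1 := ⟨d - 1, (Nat.succ_pred (NeZero.ne d)).symm⟩
    have hl' : l = Fin.last n := by
      rw [← Fin.last_add_one n] at hl; exact add_right_cancel hl
    have hkl : k - l = k + 1 := by
      rw [sub_eq_iff_eq_add, add_assoc, add_comm 1, hl, add_zero]
    have hlt : k < Fin.last n ↔ k + 1 ≠ 0 := by
      rw [← not_iff_not, not_not, not_lt]
      constructor
      · intro h
        rw [le_antisymm (Fin.le_last _) h, Fin.last_add_one]
      · intro h
        rw [← Fin.last_add_one n] at h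
        exact (add_right_cancel h).ge
    have h3 : φ (φ^[n] (c (k + 1))) = c (k + 1) :=
      (Function.iterate_succ_apply' φ n _).symm.trans (hφ _)
    rw [hl]
    simp only [twistedMatrix, Matrix.of_apply, hkl, map_mul]
    subst hl'
    rw [Fin.val_last, h3]
    simp only [hlt, companionWeight]
    by_cases hk : k + 1 = 0
    · simp [hk, mul_comm]
    · simp [hk, hπ]
  · rw [twistedMatrix_add_one_add_one hπ _ _ _ hl, companionWeight, companionWeight, if_neg hl,
      mul_one]

lemma twistedMatrix_apply_zero (φ : K →+* K) (π : K) (c : Fin d → K) (k : Fin d) :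
    twistedMatrix φ π c k 0 = c k := by
  simp [twistedMatrix]

end companionPower

open WithZero in
/-- Weights `v(x) ^ d * v(π) ^ k` at distinct `k < d` are distinct when `π` is a uniformizer. -/
lemma WithZero.eq_of_pow_mul_exp_eq {d : ℕ} {x y : WithZero (Multiplicative ℤ)} {k l : Fin d} (hx : x ≠ 0)
    (hy : y ≠ 0) (h : x ^ d * exp (-1 : ℤ) ^ (k : ℕ) = y ^ d * exp (-1 : ℤ) ^ (l : ℕ)) : k = l := by
  rw [← exp_log hx, ← exp_log hy, ← exp_nsmul, ← exp_nsmul, ← exp_nsmul, ← exp_nsmul, ← exp_add,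
    ← exp_add, exp_inj] at h
  simp only [nsmul_eq_mul, mul_neg, mul_one] at h
  have h1 : (k : ℤ) ≡ l [ZMOD d] := by
    rw [Int.modEq_iff_dvd]
    exact ⟨log y - log x, by linarith [h]⟩
  rw [Int.natCast_modEq_iff] at h1
  exact Fin.ext (Nat.ModEq.eq_of_lt_of_lt h1 k.is_lt l.is_lt)

section valuation

variable {d : ℕ} [NeZero d] {K : Type*} [Field K]

open WithZero in
lemma twistedMatrix_mulVec_ne_zero {φ : K →+* K} {π : K}
    {v : Valuation K (WithZero (Multiplicative ℤ))} (hv : ∀ x, v (φ x) = v x)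
    (hπ : v π = exp (-1 : ℤ)) {c r : Fin d → K} (hc : c ≠ 0) (hr : r ≠ 0) :
    (twistedMatrix φ π c).mulVec r ≠ 0 := by
  have hv' : ∀ (n : ℕ) x, v (φ^[n] x) = v x := by
    intro n
    induction n with
    | zero => simp
    | succ n ih => intro x; rw [Function.iterate_succ_apply, ih, hv]
  set W : (Fin d → K) → Fin d → WithZero (Multiplicative ℤ) :=
    fun r l => v (r l) ^ d * exp (-1 : ℤ) ^ (l : ℕ) with hW
  have hd : d ≠ 0 := NeZero.ne d
  have hmax : ∀ r : Fin d → K, r ≠ 0 → ∃ l, W r l ≠ 0 ∧ ∀ l', W r l' ≤ W r l := by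
    intro r hr
    obtain ⟨l, -, hl⟩ := Finset.exists_max_image Finset.univ (W r) Finset.univ_nonempty
    refine ⟨l, fun h => hr ?_, fun l' => hl l' (Finset.mem_univ _)⟩
    ext l'
    have h1 := hl l' (Finset.mem_univ _)
    rw [h, le_zero_iff] at h1
    simpa [hW, hd] using h1
  obtain ⟨l₀, hl₀, hlmax⟩ := hmax r hr
  obtain ⟨k₀, hk₀, hkmax⟩ := hmax c hc
  have hstrict : ∀ l ≠ l₀, W r l < W r l₀ := by
    intro l hl
    refine lt_of_le_of_ne (hlmax l) fun h => hl ?_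
    have hne : W r l ≠ 0 := h ▸ hl₀
    refine WithZero.eq_of_pow_mul_exp_eq (fun h0 => hne ?_) (fun h0 => hl₀ ?_) h
    · simp only [hW]; rw [h0, zero_pow hd, zero_mul]
    · simp only [hW]; rw [h0, zero_pow hd, zero_mul]
  intro h0
  have hm := congrFun h0 (k₀ + l₀)
  set m := k₀ + l₀ with hmdef
  have hterm : ∀ l, v (twistedMatrix φ π c m l * r l) ^ d * exp (-1 : ℤ) ^ (m : ℕ) =
      W c (m - l) * W r l := by
    intro l
    have hidx : (m : ℕ) + (if m < l then d else 0) = (m - l : Fin d) + l := by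
      rw [Fin.sub_def]
      have := m.is_lt
      have := l.is_lt
      split_ifs with h
      · rw [Fin.lt_def] at h
        simp only
        rw [Nat.mod_eq_of_lt (by omega)]; omega
      · rw [Fin.lt_def, not_lt] at h
        simp only
        rw [show d - (l : ℕ) + m = (m - l) + d by omega, Nat.add_mod_right,
          Nat.mod_eq_of_lt (by omega)]
        omega
    have hite : v (if m < l then π else 1) ^ d = exp (-1 : ℤ) ^ (if m < l then d else 0) := by
      split_ifs <;> simp [hπ]
    simp only [hW, twistedMatrix, Matrix.of_apply, map_mul, hv', mul_pow, hite]
    rw [mul_mul_mul_comm (v (c (m - l)) ^ d), ← pow_add, ← hidx, pow_add]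
    simp only [mul_comm, mul_left_comm, mul_assoc]
  have hlt : ∀ l ∈ Finset.univ.erase l₀,
      v (twistedMatrix φ π c m l * r l) < v (twistedMatrix φ π c m l₀ * r l₀) := by
    intro l hl
    have hl := Finset.ne_of_mem_erase hl
    have hpos : (0 : WithZero (Multiplicative ℤ)) < exp (-1 : ℤ) ^ (m : ℕ) :=
      zero_lt_iff.2 (pow_ne_zero _ exp_ne_zero)
    refine lt_of_pow_lt_pow_left₀ d zero_le ?_
    rw [← mul_lt_mul_iff_left₀ hpos, hterm, hterm, hmdef, add_sub_cancel_right]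
    exact (mul_le_mul_left (hkmax _) _).trans_lt
      (mul_lt_mul_of_pos_left (hstrict l hl) (zero_lt_iff.2 hk₀))
  have hne : v (twistedMatrix φ π c m l₀ * r l₀) ≠ 0 := by
    intro h
    have := hterm l₀
    rw [h, zero_pow hd, zero_mul, hmdef, add_sub_cancel_right] at this
    exact mul_ne_zero hk₀ hl₀ this.symm
  simp only [Matrix.mulVec, dotProduct, Pi.zero_apply] at hm
  rw [← Finset.add_sum_erase _ _ (Finset.mem_univ l₀)] at hm
  have hs := v.map_sum_lt hne hlt
  have h2 := v.map_add_eq_of_lt_left hs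
  rw [hm, map_zero] at h2
  exact hne h2.symm

open WithZero in
/-- The twisted centralizer has no zero divisors when `π` is a uniformizer fixed by `φ`. -/
lemma eq_zero_or_eq_zero_of_mem_twistedCentralizer {φ : K →+* K} {π : K}
    {v : Valuation K (WithZero (Multiplicative ℤ))} (hv : ∀ x, v (φ x) = v x)
    (hπ : v π = exp (-1 : ℤ)) (hφπ : φ π = π) {M N : Matrix (Fin d) (Fin d) K}
    (hM : M ∈ twistedCentralizer d φ π) (hMN : M * N = 0) : M = 0 ∨ N = 0 := by
  by_contra! h
  obtain ⟨hM0, hN0⟩ := h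
  have hc : (fun k => M k 0) ≠ 0 := by
    intro hc
    apply hM0
    rw [eq_twistedMatrix_of_mem hφπ hM, hc]
    ext k l
    have : ∀ n, φ^[n] 0 = 0 := fun n => iterate_map_zero φ n
    simp [twistedMatrix, this]
  obtain ⟨l, hl⟩ : ∃ l, (fun k => N k l) ≠ 0 := by
    by_contra! hN
    exact hN0 (by ext k l; exact congrFun (hN l) k)
  refine twistedMatrix_mulVec_ne_zero hv hπ hc hl ?_
  rw [← eq_twistedMatrix_of_mem hφπ hM]
  ext k
  exact congrFun (congrFun hMN k) l

end valuation

section cyclicAlgebra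

variable {F E : Type*} [Field F] [Field E] [Algebra F E]

/-- The cyclic algebra `(E / F, σ, a)`, realized inside `M_d(E)`. -/
def cyclicAlgebra (d : ℕ) [NeZero d] (σ : E →ₐ[F] E) (a : F) :
    Subalgebra F (Matrix (Fin d) (Fin d) E) where
  __ := twistedCentralizer d (σ : E →+* E) (algebraMap F E a)
  algebraMap_mem' r := by
    change companionPower d _ * (algebraMap F (Matrix (Fin d) (Fin d) E) r).map σ = _
    have : (algebraMap F (Matrix (Fin d) (Fin d) E) r).map σ = algebraMap F _ r := by
      ext k l
      simp only [Matrix.map_apply, Matrix.algebraMap_matrix_apply]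
      split_ifs <;> simp
    rw [this]
    exact (Algebra.commutes r _).symm

variable {d : ℕ} [NeZero d] {σ : E →ₐ[F] E} {a : F}

lemma mem_cyclicAlgebra {M : Matrix (Fin d) (Fin d) E} :
    M ∈ cyclicAlgebra d σ a ↔ M ∈ twistedCentralizer d (σ : E →+* E) (algebraMap F E a) := Iff.rfl

lemma finrank_cyclicAlgebra (hσ : ∀ x, σ^[d] x = x) (hd : Module.finrank F E = d) :
    Module.finrank F (cyclicAlgebra d σ a) = d ^ 2 := by
  have hπ : (σ : E →+* E) (algebraMap F E a) = algebraMap F E a := by simp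
  let f : cyclicAlgebra d σ a →ₗ[F] (Fin d → E) :=
    { toFun M k := M.1 k 0
      map_add' _ _ := rfl
      map_smul' _ _ := rfl }
  have hf : Function.Bijective f := by
    constructor
    · intro M N h
      ext1
      rw [eq_twistedMatrix_of_mem hπ (mem_cyclicAlgebra.1 M.2),
        eq_twistedMatrix_of_mem hπ (mem_cyclicAlgebra.1 N.2)]
      exact congrArg _ h
    · intro c
      exact ⟨⟨twistedMatrix (σ : E →+* E) (algebraMap F E a) c, twistedMatrix_mem hπ hσ c⟩,
        funext fun k => twistedMatrix_apply_zero _ _ c k⟩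
  have : FiniteDimensional F E := .of_finrank_pos (hd ▸ Nat.pos_of_neZero d)
  rw [(LinearEquiv.ofBijective f hf).finrank_eq, Module.finrank_pi_fintype]
  simp [hd, sq]

lemma center_cyclicAlgebra_le_bot (hσ : ∀ x, σ^[d] x = x)
    (hσ' : ∀ k, 0 < k → k < d → ∃ x, σ^[k] x ≠ x)
    (hfix : ∀ x, σ x = x → x ∈ (algebraMap F E).range) (ha : a ≠ 0) :
    Subalgebra.center F (cyclicAlgebra d σ a) ≤ ⊥ := by
  have hπ : (σ : E →+* E) (algebraMap F E a) = algebraMap F E a := by simp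
  have ha' : algebraMap F E a ≠ 0 := by simpa using ha
  rintro ⟨M, hM⟩ hc
  rw [Subalgebra.mem_center_iff] at hc
  have hc' : ∀ N ∈ cyclicAlgebra d σ a, N * M = M * N := fun N hN =>
    congrArg Subtype.val (hc ⟨N, hN⟩)
  have hMt := eq_twistedMatrix_of_mem hπ (mem_cyclicAlgebra.1 hM)
  have hdiag : ∀ (x : E) (k l : Fin d), twistedMatrix (σ : E →+* E) (algebraMap F E a)
      (Pi.single 0 x) k l = if k = l then σ^[l] x else 0 := by
    intro x k l
    have h0 : ∀ n, σ^[n] 0 = 0 := fun n => iterate_map_zero σ n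
    simp only [twistedMatrix, Matrix.of_apply, Pi.single_apply, sub_eq_zero]
    split_ifs with h1 h2 h2
    · exact absurd h2 (by simp [h1])
    · simp
    · simp [h0]
    · simp [h0]
  have hk : ∀ k, k ≠ 0 → M k 0 = 0 := by
    intro k hk
    by_contra hne
    obtain ⟨x, hx⟩ := hσ' k (Nat.pos_of_ne_zero fun h => hk (Fin.ext h)) k.is_lt
    have := congrFun (congrFun (hc' _ (twistedMatrix_mem hπ hσ (Pi.single 0 x))) k) 0
    rw [Matrix.mul_apply, Matrix.mul_apply] at this
    simp only [hdiag, ite_mul, zero_mul, mul_ite, mul_zero, Finset.sum_ite_eq,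
      Finset.sum_ite_eq', Finset.mem_univ, if_true] at this
    rw [mul_comm] at this
    exact hx (mul_left_cancel₀ hne this)
  have hM0 : (fun k => M k 0) = Pi.single 0 (M 0 0) := by
    ext k
    by_cases h : k = 0
    · simp [h]
    · simp [h, hk]
  have hfix0 : σ (M 0 0) = M 0 0 := by
    have hP : companionPower d (algebraMap F E a) ∈ cyclicAlgebra d σ a := by
      rw [mem_cyclicAlgebra, mem_twistedCentralizer, map_companionPower, hπ]
    have h1 := hc' _ hP
    have h2 := mem_twistedCentralizer.1 (mem_cyclicAlgebra.1 hM)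
    rw [← h1] at h2
    have h3 := congrFun (congrFun h2 (0 + 1)) 0
    rw [companionPower_mul_apply, companionPower_mul_apply, Matrix.map_apply] at h3
    exact mul_left_cancel₀ (companionWeight_ne_zero ha' _) h3
  obtain ⟨y, hy⟩ := hfix _ hfix0
  rw [Algebra.mem_bot]
  refine ⟨y, ?_⟩
  ext1
  change algebraMap F (Matrix (Fin d) (Fin d) E) y = M
  rw [hMt, hM0, ← hy]
  ext k l
  have hit : ∀ n, σ^[n] (algebraMap F E y) = algebraMap F E y := by
    intro n
    exact Function.iterate_fixed (by simp) n
  rw [hdiag, hit]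
  exact Matrix.algebraMap_matrix_apply

end cyclicAlgebra

lemma isSimpleRing_of_forall_isUnit {R : Type*} [Ring R] [Nontrivial R]
    (h : ∀ x : R, x ≠ 0 → IsUnit x) : IsSimpleRing R where
  simple.eq_bot_or_eq_top I := by
    by_cases hI : I = ⊥
    · exact Or.inl hI
    · right
      obtain ⟨x, hx, hx0⟩ : ∃ x ∈ I, x ≠ 0 := by
        by_contra! hx
        exact hI (le_bot_iff.1 fun x hxI => (TwoSidedIdeal.mem_bot _).2 (hx x hxI))
      obtain ⟨u, rfl⟩ := h x hx0
      refine I.one_mem_iff.1 ?_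
      have := I.mul_mem_left (↑u⁻¹) _ hx
      rwa [Units.inv_mul] at this

lemma isUnit_of_eq_zero_or_eq_zero (F : Type*) {R : Type*} [Field F] [Ring R]
    [Algebra F R] [FiniteDimensional F R] (h : ∀ x y : R, x * y = 0 → x = 0 ∨ y = 0) {x : R}
    (hx : x ≠ 0) : IsUnit x := by
  have := IsArtinianRing.of_finite F R
  refine IsArtinianRing.isUnit_of_mem_nonZeroDivisors ?_
  rw [mem_nonZeroDivisors_iff]
  exact ⟨fun y hy => (h _ _ hy).resolve_left hx, fun y hy => (h _ _ hy).resolve_right hx⟩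

section

variable {F E Ω : Type} [Field F] [Field E] [Algebra F E] [Field Ω]
  {d : ℕ} [NeZero d] {σ : E →ₐ[F] E} {a : F}

lemma map_mem_twistedCentralizer {φ : Ω →+* Ω} {ι : E →+* Ω} (hι : ∀ x, ι (σ x) = φ (ι x))
    {M : Matrix (Fin d) (Fin d) E} (hM : M ∈ cyclicAlgebra d σ a) :
    M.map ι ∈ twistedCentralizer d φ (ι (algebraMap F E a)) := by
  rw [mem_cyclicAlgebra, mem_twistedCentralizer] at hM
  have h := congrArg (fun N => N.map ι) hM
  simp only [Matrix.map_mul, map_companionPower] at h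
  rw [mem_twistedCentralizer, ← h]
  congr 1
  ext k l
  exact (hι _).symm

open WithZero in
/-- The cyclic algebra `(E / F, σ, a)` remains a division algebra over any field embedding in the
fixed field of an extension of `σ` to a discretely valued field where `a` is a uniformizer. -/
lemma isUnit_tensorProduct_cyclicAlgebra {φ : Ω →+* Ω} {ι : E →+* Ω}
    (hι : ∀ x, ι (σ x) = φ (ι x)) {v : Valuation Ω (WithZero (Multiplicative ℤ))}
    (hv : ∀ x, v (φ x) = v x) (ha : v (ι (algebraMap F E a)) = exp (-1 : ℤ))
    {N : Type} [Field N] [Algebra F N] [FiniteDimensional F N] [FiniteDimensional F E]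
    [IsSimpleRing (N ⊗[F] cyclicAlgebra d σ a)] (f : N →+* Ω)
    (hf : ∀ x : F, f (algebraMap F N x) = ι (algebraMap F E x)) (hfφ : ∀ x, φ (f x) = f x)
    {z : N ⊗[F] cyclicAlgebra d σ a} (hz : z ≠ 0) : IsUnit z := by
  let : Algebra F Ω := (ι.comp (algebraMap F E)).toAlgebra
  let f' : N →ₐ[F] Ω := { f with commutes' := hf }
  let ι' : E →ₐ[F] Ω := { ι with commutes' := fun _ => rfl }
  let g₁ : N →ₐ[F] Matrix (Fin d) (Fin d) Ω := (Algebra.ofId Ω _ |>.restrictScalars F).comp f'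
  let g₂ : cyclicAlgebra d σ a →ₐ[F] Matrix (Fin d) (Fin d) Ω :=
    ι'.mapMatrix.comp (cyclicAlgebra d σ a).val
  let g := Algebra.TensorProduct.lift g₁ g₂ fun x y => Algebra.commutes (f x) (g₂ y)
  have hφa : φ (ι (algebraMap F E a)) = ι (algebraMap F E a) := by rw [← hι, σ.commutes]
  have hg : ∀ z, g z ∈ twistedCentralizer d φ (ι (algebraMap F E a)) := by
    intro z
    induction z with
    | zero => rw [map_zero]; exact Subring.zero_mem _
    | add x y hx hy => rw [map_add]; exact Subring.add_mem _ hx hy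
    | tmul x y =>
      have hxy : g (x ⊗ₜ y) = g₁ x * g₂ y := Algebra.TensorProduct.lift_tmul _ _ _ _ _
      rw [hxy]
      refine Subring.mul_mem _ ?_ (map_mem_twistedCentralizer hι y.2)
      change algebraMap Ω _ (f x) ∈ _
      rw [mem_twistedCentralizer]
      have : (algebraMap Ω (Matrix (Fin d) (Fin d) Ω) (f x)).map φ = algebraMap Ω _ (f x) := by
        ext k l
        simp only [Matrix.map_apply, Matrix.algebraMap_matrix_apply]
        split_ifs <;> simp [hfφ]
      rw [this]
      exact (Algebra.commutes _ _).symm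
  have hinj : Function.Injective g := g.toRingHom.injective
  refine isUnit_of_eq_zero_or_eq_zero F (fun x y hxy => ?_) hz
  have hxy' : g x * g y = 0 := by rw [← map_mul, hxy, map_zero]
  exact (eq_zero_or_eq_zero_of_mem_twistedCentralizer hv ha hφa (hg x) hxy').imp
    (fun h => hinj (by rw [h, map_zero])) (fun h => hinj (by rw [h, map_zero]))

open WithZero in
lemma isUnit_cyclicAlgebra {φ : Ω →+* Ω} {ι : E →+* Ω}
    (hι : ∀ x, ι (σ x) = φ (ι x)) {v : Valuation Ω (WithZero (Multiplicative ℤ))}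
    (hv : ∀ x, v (φ x) = v x) (ha : v (ι (algebraMap F E a)) = exp (-1 : ℤ))
    [FiniteDimensional F E] {z : cyclicAlgebra d σ a} (hz : z ≠ 0) : IsUnit z := by
  have hφa : φ (ι (algebraMap F E a)) = ι (algebraMap F E a) := by rw [← hι, σ.commutes]
  have hinj : ∀ x : cyclicAlgebra d σ a, (x : Matrix (Fin d) (Fin d) E).map ι = 0 → x = 0 := by
    intro x hx
    refine Subtype.ext (Matrix.map_injective ι.injective ?_)
    refine hx.trans ?_
    ext
    simp
  refine isUnit_of_eq_zero_or_eq_zero F (fun x y hxy => ?_) hz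
  have hxy' : (x : Matrix (Fin d) (Fin d) E).map ι * (y : Matrix (Fin d) (Fin d) E).map ι = 0 := by
    rw [← Matrix.map_mul]
    have : (x : Matrix (Fin d) (Fin d) E) * y = 0 := congrArg Subtype.val hxy
    rw [this]
    ext
    simp
  exact (eq_zero_or_eq_zero_of_mem_twistedCentralizer hv ha hφa
    (map_mem_twistedCentralizer hι x.2) hxy').imp (hinj x) (hinj y)

end

section

open WithZero IsDedekindDomain

lemma exists_teichmuller_frobenius (p q : ℕ) [Fact p.Prime] [Fact q.Prime] (hpq : p ≠ q) :
    ∃ (Ω : Type) (_ : Field Ω) (φ : Ω →+* Ω) (v : Valuation Ω (WithZero (Multiplicative ℤ)))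
      (f : ℚ_[p] →+* Ω) (τ : Ω), (∀ x, v (φ x) = v x) ∧ v (p : Ω) = exp (-1 : ℤ) ∧
      (∀ x, φ (f x) = f x) ∧ IsPrimitiveRoot τ q ∧ φ τ = τ ^ p := by
  let k := AlgebraicClosure (ZMod p)
  let W := WittVector p k
  let Ω := FractionRing W
  have hp0 : (p : W) ≠ 0 := (WittVector.irreducible p).ne_zero
  let P : HeightOneSpectrum W :=
    ⟨Ideal.span {(p : W)}, (Ideal.span_singleton_prime hp0).2 (WittVector.irreducible p).prime,
      by simpa using hp0⟩
  let v : Valuation Ω (WithZero (Multiplicative ℤ)) := P.valuation Ω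
  let φ : Ω →+* Ω := WittVector.FractionRing.frobeniusRingHom p k
  have hφ : ∀ x : W, φ (algebraMap W Ω x) = algebraMap W Ω (WittVector.frobenius x) := fun x =>
    IsFractionRing.ringEquivOfRingEquiv_algebraMap _ _
  have hvp : v (p : Ω) = exp (-1 : ℤ) := by
    rw [← map_natCast (algebraMap W Ω)]
    exact (P.valuation_of_algebraMap _).trans (P.intValuation_singleton hp0 rfl)
  have hvu : ∀ u : W, IsUnit u → v (algebraMap W Ω u) = 1 := by
    rintro _ ⟨u, rfl⟩
    refine le_antisymm (P.valuation_le_one _) ?_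
    have h1 : v (algebraMap W Ω u) * v (algebraMap W Ω ↑u⁻¹) = 1 := by
      rw [← map_mul, ← map_mul, Units.mul_inv, map_one, map_one]
    rw [← h1]
    exact mul_le_of_le_one_right' (P.valuation_le_one _)
  have hvW : ∀ x : W, v (φ (algebraMap W Ω x)) = v (algebraMap W Ω x) := by
    intro x
    by_cases hx : x = 0
    · simp [hx]
    obtain ⟨m, u, rfl⟩ := WittVector.exists_eq_pow_p_mul' x hx
    have hfp : WittVector.frobenius (p : W) = p := map_natCast _ p
    rw [hφ]
    simp only [map_mul, map_pow, hfp]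
    rw [hvu _ u.isUnit, hvu _ (u.isUnit.map _)]
  let j : ℤ_[p] →+* Ω := (algebraMap W Ω).comp
    ((WittVector.map (algebraMap (ZMod p) k)).comp (WittVector.fromPadicInt p))
  have hj : Function.Injective j := by
    refine (IsFractionRing.injective W Ω).comp (Function.Injective.comp ?_ ?_)
    · exact WittVector.map_injective _ (algebraMap (ZMod p) k).injective
    · exact (WittVector.equiv p).symm.injective
  have hjφ : ∀ x, φ (j x) = j x := by
    intro x
    simp only [j, RingHom.comp_apply, hφ]
    congr 1
    rw [WittVector.frobenius_eq_map_frobenius]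
    ext n
    rw [WittVector.map_coeff, WittVector.map_coeff, frobenius_def, ← map_pow, ZMod.pow_card]
  obtain ⟨ζ, hζ⟩ : ∃ ζ : k, IsPrimitiveRoot ζ q := by
    have : NeZero (q : k) := ⟨by
      rw [Ne, CharP.cast_eq_zero_iff k p]
      exact fun h => hpq ((Nat.prime_dvd_prime_iff_eq Fact.out Fact.out).1 h)⟩
    exact HasEnoughRootsOfUnity.exists_primitiveRoot k q
  refine ⟨Ω, inferInstance, φ, v, IsFractionRing.lift hj,
    algebraMap W Ω (WittVector.teichmuller p ζ), ?_, hvp, ?_, ?_, ?_⟩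
  · intro x
    obtain ⟨a, b, -, rfl⟩ := IsFractionRing.div_surjective (A := W) x
    simp only [map_div₀, hvW]
  · intro x
    obtain ⟨a, b, -, rfl⟩ := IsFractionRing.div_surjective (A := ℤ_[p]) x
    simp only [map_div₀, IsFractionRing.lift_algebraMap, hjφ]
  · refine (hζ.map_of_injective (f := WittVector.teichmuller p) ?_).map_of_injective
      (IsFractionRing.injective W Ω)
    intro x y h
    simpa using congrArg (fun w => WittVector.coeff w 0) h
  · rw [hφ, WittVector.frobenius_eq_map_frobenius, WittVector.map_teichmuller, frobenius_def,
      map_pow, map_pow]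

end

lemma exists_cyclic_subfield_cyclotomicField {p q d : ℕ} [Fact q.Prime] (hd0 : d ≠ 0)
    (hd : d ∣ q - 1) {g : (ZMod q)ˣ} (hg : ∀ x, x ∈ Subgroup.zpowers g) (hpg : (p : ZMod q) = g)
    {Ω : Type} [Field Ω] [CharZero Ω] (φ : Ω →+* Ω) {τ : Ω} (hτ : IsPrimitiveRoot τ q)
    (hφ : φ τ = τ ^ p) :
    ∃ (E : Type) (_ : Field E) (_ : Algebra ℚ E) (σ : E →ₐ[ℚ] E) (ι : E →+* Ω),
      Module.finrank ℚ E = d ∧ (∀ x, σ^[d] x = x) ∧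
      (∀ k, 0 < k → k < d → ∃ x, σ^[k] x ≠ x) ∧
      (∀ x, σ x = x → x ∈ (algebraMap ℚ E).range) ∧ ∀ x, ι (σ x) = φ (ι x) := by
  have hq0 : 0 < q := (Fact.out : q.Prime).pos
  let C := CyclotomicField q ℚ
  have : NeZero (q : ℚ) := ⟨by exact_mod_cast hq0.ne'⟩
  have : IsCyclotomicExtension {q} ℚ C := CyclotomicField.isCyclotomicExtension q ℚ
  have hirr := Polynomial.cyclotomic.irreducible_rat hq0
  let e : (C ≃ₐ[ℚ] C) ≃* (ZMod q)ˣ := IsCyclotomicExtension.autEquivPow C hirr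
  let s : C ≃ₐ[ℚ] C := e.symm g
  have hζ := IsCyclotomicExtension.zeta_spec q ℚ C
  have hsζ : s (IsCyclotomicExtension.zeta q ℚ C) =
      IsCyclotomicExtension.zeta q ℚ C ^ (p : ZMod q).val := by
    rw [← hζ.autToPow_spec ℚ s]
    congr 2
    rw [hpg]
    exact congrArg Units.val (e.apply_symm_apply g)
  have hs : ∀ x, x ∈ Subgroup.zpowers s := by
    intro x
    obtain ⟨n, hn⟩ := hg (e x)
    refine ⟨n, e.injective ?_⟩
    simp only at hn ⊢
    rw [map_zpow, ← hn, e.apply_symm_apply]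
  have hcard : Nat.card (C ≃ₐ[ℚ] C) = q - 1 := by
    rw [Nat.card_congr e.toEquiv, Nat.card_eq_fintype_card, ZMod.card_units]
  have hord : orderOf s = q - 1 := by
    rw [← Nat.card_zpowers, (Subgroup.eq_top_iff' _).2 hs, Subgroup.card_top, hcard]
  let H := Subgroup.zpowers (s ^ d)
  let E := IntermediateField.fixedField H
  have : IsGalois ℚ C := IsCyclotomicExtension.isGalois {q} ℚ C
  have : FiniteDimensional ℚ C := IsCyclotomicExtension.finiteDimensional {q} ℚ C
  have hH : Nat.card H * d = q - 1 := by
    rw [Nat.card_zpowers, orderOf_pow_of_dvd hd0 (hord ▸ hd), hord, Nat.div_mul_cancel hd]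
  have hE : Module.finrank ℚ E = d := by
    have h1 := Module.finrank_mul_finrank ℚ E C
    rw [IntermediateField.finrank_fixedField_eq_card, ← IsGalois.card_aut_eq_finrank ℚ C, hcard,
      ← hH, mul_comm] at h1
    exact mul_left_cancel₀ Nat.card_pos.ne' h1
  have hmem : ∀ x : C, x ∈ E ↔ (s ^ d) x = x := by
    intro x
    rw [IntermediateField.mem_fixedField_iff]
    constructor
    · intro h
      exact h _ (Subgroup.mem_zpowers _)
    · rintro h _ ⟨n, rfl⟩
      have : s ^ d ∈ MulAction.stabilizer (C ≃ₐ[ℚ] C) x := h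
      exact Subgroup.zpow_mem _ this n
  have hsE : ∀ x : E, s x ∈ E.toSubalgebra := by
    intro x
    change s x ∈ E
    rw [hmem, ← AlgEquiv.mul_apply, ← pow_succ, pow_succ', AlgEquiv.mul_apply, (hmem x).1 x.2]
  let σ : E →ₐ[ℚ] E := AlgHom.codRestrict (s.toAlgHom.comp E.val) E.toSubalgebra hsE
  have hσ : ∀ x : E, (σ x : C) = s x := fun _ => rfl
  have hσn : ∀ (n : ℕ) (x : E), ((σ^[n] x : E) : C) = (s ^ n) x := by
    intro n
    induction n with
    | zero => intro x; simp
    | succ n ih => intro x; rw [Function.iterate_succ_apply', hσ, ih, pow_succ', AlgEquiv.mul_apply]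
  let : Algebra ℚ Ω := DivisionRing.toRatAlgebra
  let B := hζ.powerBasis ℚ
  have hroot : Polynomial.aeval τ (minpoly ℚ B.gen) = 0 := by
    rw [IsPrimitiveRoot.powerBasis_gen, ← hζ.minpoly_eq_cyclotomic_of_irreducible hirr,
      Polynomial.aeval_def, Polynomial.eval₂_eq_eval_map, Polynomial.map_cyclotomic]
    exact hτ.isRoot_cyclotomic hq0
  let ι : C →ₐ[ℚ] Ω := B.lift τ hroot
  have hιζ : ι (IsCyclotomicExtension.zeta q ℚ C) = τ := by
    have := B.lift_gen τ hroot
    rwa [IsPrimitiveRoot.powerBasis_gen] at this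
  have hι : ∀ x, ι (s x) = φ (ι x) := by
    let φ' : Ω →ₐ[ℚ] Ω := φ.toRatAlgHom
    have : ι.comp s.toAlgHom = φ'.comp ι := by
      apply B.algHom_ext
      rw [IsPrimitiveRoot.powerBasis_gen]
      change ι (s _) = φ (ι _)
      rw [hsζ, map_pow, hιζ, hφ, ZMod.val_natCast, ← pow_mod_orderOf τ p, ← hτ.eq_orderOf]
    exact fun x => congrArg (fun f : C →ₐ[ℚ] Ω => f x) this
  refine ⟨E, inferInstance, inferInstance, σ, (ι : C →+* Ω).comp (algebraMap E C), hE, ?_, ?_, ?_,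
    fun x => hι x⟩
  · intro x
    ext1
    rw [hσn]
    exact (hmem x).1 x.2
  · intro k hk hkd
    by_contra! h
    have h1 : s ^ k ∈ IntermediateField.fixingSubgroup E := by
      rw [IntermediateField.mem_fixingSubgroup_iff]
      intro x hx
      have := congrArg (fun y : E => (y : C)) (h ⟨x, hx⟩)
      simpa only [hσn] using this
    rw [IntermediateField.fixingSubgroup_fixedField] at h1
    have h2 := (Subgroup.zpowers_le.2 h1)
    have h3 := Subgroup.card_dvd_of_le h2
    rw [Nat.card_zpowers] at h3
    have h4 : (s ^ k) ^ Nat.card H = 1 := orderOf_dvd_iff_pow_eq_one.1 h3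
    rw [← pow_mul] at h4
    have h5 := orderOf_dvd_of_pow_eq_one h4
    rw [hord, ← hH, mul_comm] at h5
    exact absurd (Nat.le_of_dvd hk (Nat.dvd_of_mul_dvd_mul_right Nat.card_pos h5)) (by omega)
  · intro x hx
    have h1 : (x : C) ∈ (⊥ : IntermediateField ℚ C) := by
      rw [IsGalois.mem_bot_iff_fixed]
      intro f
      obtain ⟨n, rfl⟩ := hs f
      have : s ∈ MulAction.stabilizer (C ≃ₐ[ℚ] C) (x : C) := by
        rw [MulAction.mem_stabilizer_iff, AlgEquiv.smul_def, ← hσ, hx]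
      exact Subgroup.zpow_mem _ this n
    obtain ⟨y, hy⟩ := IntermediateField.mem_bot.1 h1
    exact ⟨y, Subtype.ext hy⟩

lemma CSAlg.isCentral {k : Type} [Field k] (A : CSAlg k) : Algebra.IsCentral k A.carrier :=
  ⟨A.center_le_bot⟩

/-- There is a cyclic algebra of degree `d` over `ℚ` that stays a division algebra over every
number field embedding in `ℚ_p`, provided that `p` generates `(ℤ/q)ˣ` with `q ≡ 1 mod d`. -/
lemma exists_cSAlg_isUnit_tensorProduct {p q d : ℕ} [Fact p.Prime] [Fact q.Prime] (hpq : p ≠ q)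
    (hd0 : d ≠ 0) (hd : d ∣ q - 1) {g : (ZMod q)ˣ} (hg : ∀ x, x ∈ Subgroup.zpowers g)
    (hpg : (p : ZMod q) = g) :
    ∃ B : CSAlg ℚ, B.DegreeEq d ∧ ∀ (N : NumField), (N.carrier →+* ℚ_[p]) →
      ∀ z : N.carrier ⊗[ℚ] B.carrier, z ≠ 0 → IsUnit z := by
  obtain ⟨Ω, _, φ, v, f, τ, hv, hvp, hf, hτ, hφτ⟩ := exists_teichmuller_frobenius p q hpq
  have : CharZero Ω := charZero_of_injective_ringHom f.injective
  obtain ⟨E, _, _, σ, ι, hE, hσ, hσ', hfix, hι⟩ :=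
    exists_cyclic_subfield_cyclotomicField hd0 hd hg hpg φ hτ hφτ
  have : NeZero d := ⟨hd0⟩
  have hp0 : (p : ℚ) ≠ 0 := by exact_mod_cast (Fact.out : p.Prime).ne_zero
  have hvp' : v (ι (algebraMap ℚ E p)) = WithZero.exp (-1 : ℤ) := by
    rw [map_natCast, map_natCast, hvp]
  have : FiniteDimensional ℚ E := .of_finrank_pos (hE ▸ Nat.pos_of_neZero d)
  have hsimple : IsSimpleRing (cyclicAlgebra d σ (p : ℚ)) :=
    isSimpleRing_of_forall_isUnit fun _ hx => isUnit_cyclicAlgebra hι hv hvp' hx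
  let B : CSAlg ℚ :=
    { carrier := cyclicAlgebra d σ (p : ℚ)
      finiteDimensional := inferInstance
      isSimpleRing := hsimple
      center_le_bot := center_cyclicAlgebra_le_bot hσ hσ' hfix hp0 }
  have hc : Algebra.IsCentral ℚ (cyclicAlgebra d σ (p : ℚ)) := B.isCentral
  refine ⟨B, finrank_cyclicAlgebra hσ hE, fun N h z hz => ?_⟩
  have : IsSimpleRing (N.carrier ⊗[ℚ] cyclicAlgebra d σ (p : ℚ)) :=
    isSimpleRing_tensorProduct ℚ N.carrier _
  exact isUnit_tensorProduct_cyclicAlgebra hι hv hvp' (f.comp h)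
    (fun x => by simp) (fun x => hf _) hz

/-- Base change of a central simple algebra. -/
def CSAlg.baseChange {F : Type} [Field F] (B : CSAlg F) (K : Type) [Field K] [Algebra F K] :
    CSAlg K where
  carrier := K ⊗[F] B.carrier
  finiteDimensional := by
    have := B.finiteDimensional
    infer_instance
  isSimpleRing := by
    have := B.finiteDimensional
    have := B.isSimpleRing
    have := B.isCentral
    exact isSimpleRing_tensorProduct F K B.carrier
  center_le_bot := by
    have := B.isSimpleRing
    have := B.isCentral
    exact (isCentral_tensorProduct F K K B.carrier).out

lemma CSAlg.DegreeEq.baseChange {F : Type} [Field F] {B : CSAlg F} {d : ℕ} (h : B.DegreeEq d)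
    (K : Type) [Field K] [Algebra F K] : (B.baseChange K).DegreeEq d :=
  (Module.finrank_baseChange (R := K)).trans h

lemma inFiber_baseChange_self {F : Type} [Field F] (B : CSAlg F) (K : Type) [Field K]
    [Algebra F K] : InFiber F K (B.baseChange K) B :=
  IsBrauerEquiv.of_algEquiv AlgEquiv.refl

lemma InFiber.of_isTowerPoint {N N' : NumField} {n M l i : ℕ} {c c' : ℤ} (hc : c' * c = -3)
    (hN : Module.finrank ℚ N.carrier = 2 ^ n) {x y m : N'.carrier} (h : IsTowerPoint M c' x y)
    (hm : m ^ 2 ^ i = l)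
    (hemb : ∀ (Ω : Type) [Field Ω] [CharZero Ω] (x y m : Ω), IsTowerPoint M c x y →
      m ^ 2 ^ i = l → Nonempty (N.carrier →+* Ω))
    {B B₀ : CSAlg ℚ} (hB : InFiber ℚ N.carrier (B₀.baseChange N.carrier) B) :
    InFiber ℚ N'.carrier (B₀.baseChange N'.carrier) B := by
  obtain ⟨L, _, _, _, hodd, x', y', h'⟩ := h.exists_odd_extension hc
  have : CharZero L := charZero_of_injective_algebraMap (algebraMap N'.carrier L).injective
  obtain ⟨f⟩ := hemb L x' y' (algebraMap _ L m) h' (by rw [← map_pow, hm, map_natCast])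
  let : Algebra N.carrier L := f.toAlgebra
  have := B.finiteDimensional
  have := B.isSimpleRing
  have := B.isCentral
  have := B₀.finiteDimensional
  have := B₀.isSimpleRing
  have := B₀.isCentral
  refine isBrauerEquiv_tensor_of_split_imp (K := N.carrier) ?_ hB
  intro C _ _ _ _ _ hsplit
  exact isBrauerEquiv_baseChange_of_odd hN hodd hsplit

lemma exists_primes_of_dvd {d : ℕ} (hd : d ≠ 0) :
    ∃ p q : ℕ, p.Prime ∧ q.Prime ∧ p ≠ q ∧ p ≡ 1 [MOD 3] ∧ d ∣ q - 1 ∧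
      ∃ g : (ZMod q)ˣ, (∀ x, x ∈ Subgroup.zpowers g) ∧ (p : ZMod q) = g := by
  obtain ⟨q, hq, hq3, hqd⟩ := Nat.exists_prime_gt_modEq_one 3 hd
  have := Fact.mk hq
  obtain ⟨g, hg⟩ := IsCyclic.exists_generator (α := (ZMod q)ˣ)
  have hco : Nat.Coprime 3 q := (Nat.coprime_primes Nat.prime_three hq).2 hq3.ne
  have : NeZero (3 * q) := ⟨by positivity⟩
  let e := ZMod.chineseRemainder hco
  have hu : IsUnit (e.symm (1, (g : ZMod q))) :=
    (Prod.isUnit_iff.2 ⟨isUnit_one, g.isUnit⟩).map e.symm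
  obtain ⟨p, hpq, hp, hpe⟩ := Nat.forall_exists_prime_gt_and_eq_mod hu q
  have he : e (p : ZMod (3 * q)) = (1, (g : ZMod q)) := by rw [hpe, e.apply_symm_apply]
  rw [map_natCast] at he
  refine ⟨p, q, hp, hq, hpq.ne', ?_, (Nat.modEq_iff_dvd' hq.one_le).1 hqd.symm, g, hg,
    congrArg Prod.snd he⟩
  rw [← ZMod.natCast_eq_natCast_iff]
  simpa using congrArg Prod.fst he

/-- For every `j ≥ 3` and `d ≥ 2`, there exist non-isomorphic number
fields `K, K'` of degree `2 ^ j` over `ℚ`, and central division algebras `A/K`, `A'/K'`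
of degree `d` with the same fiber of the restriction map over `ℚ`, and with a common
member `B₀` of the two fibers. -/
theorem stmt_1 (j d : ℕ) (hj : 3 ≤ j) (hd : 2 ≤ d) :
    ∃ (K K' : NumField),
      Module.finrank ℚ K.carrier = 2 ^ j ∧ Module.finrank ℚ K'.carrier = 2 ^ j ∧
      IsEmpty (K.carrier ≃+* K'.carrier) ∧
      ∃ (A : CSAlg K.carrier) (A' : CSAlg K'.carrier),
        A.IsDivision ∧ A.DegreeEq d ∧ A'.IsDivision ∧ A'.DegreeEq d ∧
        (∀ B : CSAlg ℚ, InFiber ℚ K.carrier A B ↔ InFiber ℚ K'.carrier A' B) ∧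
        ∃ B₀ : CSAlg ℚ, InFiber ℚ K.carrier A B₀ ∧ InFiber ℚ K'.carrier A' B₀ := by
  obtain ⟨i, rfl⟩ := Nat.exists_eq_add_of_le' hj
  obtain ⟨p, q, hp, hq, hpq, hp3, hdq, g, hg, hpg⟩ := exists_primes_of_dvd (d := d) (by omega)
  obtain ⟨l, hl, -, hl1⟩ := Nat.exists_prime_gt_modEq_one 0 (k := 3 * p)
    (by have := hp.pos; positivity)
  have := Fact.mk hp
  have := Fact.mk hq
  have := Fact.mk hl
  have hl3 : l ≡ 1 [MOD 3] := hl1.of_mul_right p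
  have hlp : l ≡ 1 [MOD p] := hl1.of_mul_left 3
  have hM : p * l ≡ 1 [MOD 3] := by simpa using hp3.mul hl3
  obtain ⟨K, hK, ⟨x, y, m, hxy, hm⟩, hKemb⟩ :=
    exists_tower (c := 1) hM hl3 (Dvd.intro_left p rfl) (Or.inl rfl) i
  obtain ⟨K', hK', ⟨x', y', m', hxy', hm'⟩, hKemb'⟩ :=
    exists_tower (c := -3) hM hl3 (Dvd.intro_left p rfl) (Or.inr rfl) i
  have hp2 : p ≠ 2 := by rintro rfl; exact absurd hp3 (by decide)
  obtain ⟨μ, hμ⟩ := exists_pow_two_pow_eq_padic hp2 hlp i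
  obtain ⟨f⟩ : Nonempty (K.carrier →+* ℚ_[p]) := by
    obtain ⟨a, b, hab⟩ := exists_isTowerPoint_padic hp3 (Dvd.intro l rfl) (Or.inl rfl)
    exact hKemb _ a b μ hab hμ
  obtain ⟨f'⟩ : Nonempty (K'.carrier →+* ℚ_[p]) := by
    obtain ⟨a, b, hab⟩ := exists_isTowerPoint_padic hp3 (Dvd.intro l rfl) (Or.inr rfl)
    exact hKemb' _ a b μ hab hμ
  obtain ⟨fR⟩ : Nonempty (K'.carrier →+* ℝ) := by
    obtain ⟨a, b, hab⟩ := exists_isTowerPoint_real (p * l)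
    refine hKemb' _ a b ((l : ℝ) ^ (((2 ^ i : ℕ) : ℝ)⁻¹)) hab ?_
    exact Real.rpow_inv_natCast_pow l.cast_nonneg (by positivity)
  obtain ⟨B₀, hB₀, hdiv⟩ := exists_cSAlg_isUnit_tensorProduct hpq (by omega) hdq hg hpg
  refine ⟨K, K', hK, hK', ?_, B₀.baseChange _, B₀.baseChange _, hdiv K f, hB₀.baseChange _,
    hdiv K' f', hB₀.baseChange _, fun B => ⟨?_, ?_⟩, B₀, inFiber_baseChange_self _ _,
    inFiber_baseChange_self _ _⟩
  · exact isEmpty_ringEquiv_of_isTowerPoint (mul_ne_zero hp.ne_zero hl.ne_zero) hK' hxy hxy' fR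
  · exact InFiber.of_isTowerPoint (by norm_num) hK hxy' hm' hKemb
  · exact InFiber.of_isTowerPoint (by norm_num) hK' hxy hm hKemb'
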